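/- For each q ∈ {2, 4, 5}, there does not exist a set of three mutually orthogoval projective planes of order q. That is, there are no three families L₁, L₂, L₃ of (q+1)-element subsets of a (q²+q+1)-element set, each family having the property that every two distinct points lie in exactly one of its members, such that for all i ≠ j every member of L_i intersects every member of L_j in at most two points. -/

import Mathlib

namespace Ogo

/-! ### A small search engine on bit masks, written for kernel evaluation -/

/-- Boolean case distinction. -/
def cnd {α : Type} (b : Bool) (x y : α) : α := Bool.rec y x b

/-- `m` contains the mask `b`. -/
def has (m b : ℕ) : Bool := Nat.beq (Nat.land m b) b

/-- Exactly one bit is set. -/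
noncomputable def one (x : ℕ) : Bool :=
  Nat.rec false (fun n _ => Nat.beq (Nat.land n (Nat.succ n)) 0) x

/-- At most two bits are set. -/
noncomputable def le2 (x : ℕ) : Bool :=
  Nat.rec true (fun n _ => Nat.rec true (fun k _ => Nat.beq (Nat.land k (Nat.succ k)) 0)
    (Nat.land n (Nat.succ n))) x

/-- Filtering in continuation passing style. -/
noncomputable def filtK (p : ℕ → Bool) (l : List ℕ) : List ℕ → (List ℕ → Bool) → Bool :=
  List.rec (fun acc k => k acc)
    (fun a _ ih acc k => cnd (p a) (ih (List.cons a acc) k) (ih acc k)) l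

/-- Filtering by all `p c`, `c ∈ cs`. -/
noncomputable def filtAllK (p : ℕ → ℕ → Bool) (cs : List ℕ) :
    List ℕ → (List ℕ → Bool) → Bool :=
  List.rec (fun l k => k l) (fun c _ ih l k => filtK (p c) l [] (fun l' => ih l' k)) cs

/-- All members of the list satisfy `p`. -/
noncomputable def allL (l : List ℕ) (p : ℕ → Bool) : Bool :=
  List.rec true (fun a _ ih => cnd (p a) ih false) l

/-- Union of the members of the list which contain `P`. -/
noncomputable def cover (P : ℕ) (l : List ℕ) : ℕ :=
  List.rec P (fun c _ ih => cnd (has c P) (Nat.lor c ih) ih) l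

/-- Choose all blocks through the point `P`. -/
noncomputable def pencil (P : ℕ) (js : List ℕ) :
    List ℕ → ℕ → List ℕ → (List ℕ → Bool) → Bool :=
  List.rec (fun _ _ new k => k new)
    (fun j _ ih cand cov new k => cnd (has cov j) (ih cand cov new k)
      (allL cand (fun c => cnd (has c j)
        (filtK (fun d => Nat.beq (Nat.land d c) P) cand []
          (fun cand' => ih cand' (Nat.lor cov c) (List.cons c new) k)) true))) js

/-- Choose all blocks through all centres. -/
noncomputable def levels (js : List ℕ) (kf : List ℕ → List ℕ → Bool)
    (bs : List (ℕ × List ℕ)) : List ℕ → List ℕ → Bool :=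
  List.rec kf
   (fun b _ ih chosen a3 =>
     filtAllK (fun c d => cnd (one (Nat.land c d)) true (Nat.beq c d)) chosen b.2 (fun cand =>
       pencil b.1 js cand (cover b.1 chosen) List.nil (fun new =>
         filtAllK (fun c d => le2 (Nat.land c d)) new a3 (fun a3' =>
           List.rec true (fun _ _ _ => ih (List.append new chosen) a3') a3')))) bs

/-- Remove from `al` all lines which are forbidden. -/
noncomputable def remK (t cur : ℕ) (ls : List ℕ) : ℕ → (ℕ → Bool) → Bool :=
  List.rec (fun al k => k al)
    (fun l _ ih al k => Nat.rec (ih al k)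
      (fun _ _ => Nat.rec (ih 0 k) (fun n _ => ih (Nat.succ n) k)
        (Nat.xor al (Nat.land al l))) (Nat.lor t (Nat.land l cur))) ls

/-- Generate all sets of a given size which meet all lines in few points. -/
noncomputable def gen (t : ℕ) (pts : List (ℕ × List ℕ)) :
    ℕ → ℕ → ℕ → List ℕ → (List ℕ → Bool) → Bool :=
  List.rec (fun need cur _ acc k => Nat.rec (k (List.cons cur acc)) (fun _ _ => k acc) need)
   (fun b _ ih need cur al acc k =>
     Nat.rec (k (List.cons cur acc)) (fun need' _ =>
      cnd (has al b.1)
       (remK t cur b.2 al (fun al' => ih need' (Nat.lor cur b.1) al' acc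
          (fun acc' => ih (Nat.succ need') cur al acc' k)))
       (ih (Nat.succ need') cur al acc k)) need) pts

/-- Attach to every point the list of lines through it. -/
noncomputable def ptsK (lines : List ℕ) (js : List ℕ) :
    List (ℕ × List ℕ) → (List (ℕ × List ℕ) → Bool) → Bool :=
  List.rec (fun acc k => k acc)
    (fun j _ ih acc k => filtK (fun l => has l j) lines []
      (fun ls => ih (List.cons (j, ls) acc) k)) js

/-- Candidate blocks through the centres `ps`. -/
noncomputable def bucketsK (t q full : ℕ) (pts : List (ℕ × List ℕ)) (known : List ℕ)
    (ps : List ℕ) : List (ℕ × List ℕ) → (List (ℕ × List ℕ) → Bool) → Bool :=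
  List.rec (fun acc k => k acc)
    (fun P _ ih acc k => filtK (fun l => has l P) known [] (fun ks =>
      gen t pts q P (Nat.xor full (cover P known)) ks
        (fun l => ih (List.cons (P, l) acc) k))) ps

/-! ### Soundness -/

theorem cnd_true {α : Type} (x y : α) : cnd true x y = x := rfl
theorem cnd_false {α : Type} (x y : α) : cnd false x y = y := rfl

theorem beq_nat_iff {a b : ℕ} : Nat.beq a b = true ↔ a = b :=
  ⟨Nat.eq_of_beq_eq_true, fun h => h ▸ Nat.beq_refl a⟩

/-- The set of bits. -/
def bits (n c : ℕ) : Finset ℕ := (Finset.range n).filter (fun i => c.testBit i = true)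

theorem mem_bits {n c i : ℕ} : i ∈ bits n c ↔ i < n ∧ c.testBit i = true := by
  simp [bits]

theorem has_iff {m b : ℕ} : has m b = true ↔ ∀ i, b.testBit i = true → m.testBit i = true := by
  unfold has
  rw [beq_nat_iff]
  constructor
  · intro h i hi
    have := congrArg (fun x => x.testBit i) h
    simp only [show Nat.land m b = m &&& b from rfl, Nat.testBit_and, hi] at this
    simpa using this
  · intro h
    apply Nat.eq_of_testBit_eq
    intro i
    simp only [show Nat.land m b = m &&& b from rfl, Nat.testBit_and]
    specialize h i
    cases hb : b.testBit i <;> simp_all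

theorem has_two_pow {m i : ℕ} : has m (2 ^ i) = true ↔ m.testBit i = true := by
  rw [has_iff]
  constructor
  · intro h; exact h i (by simp [Nat.testBit_two_pow_self])
  · intro h j hj
    rw [Nat.testBit_two_pow] at hj
    simp at hj; subst hj; exact h

theorem land_pred_eq_zero (n : ℕ) (h : n &&& (n + 1) = 0) : ∃ i, n + 1 = 2 ^ i := by
  have := (Nat.and_sub_one_eq_zero_iff_isPowerOfTwo (n := n + 1) (by omega)).1
    (by rw [Nat.and_comm]; simpa using h)
  obtain ⟨k, hk⟩ := this
  exact ⟨k, hk⟩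

theorem one_two_pow (i : ℕ) : one (2 ^ i) = true := by
  obtain ⟨n, hn⟩ : ∃ n, 2 ^ i = n + 1 := ⟨2 ^ i - 1, by have := Nat.two_pow_pos i; omega⟩
  rw [hn]
  show Nat.beq (Nat.land n (Nat.succ n)) 0 = true
  rw [beq_nat_iff]
  have := (Nat.and_sub_one_eq_zero_iff_isPowerOfTwo (n := n + 1) (by omega)).2 ⟨i, hn.symm⟩
  rw [Nat.and_comm] at this
  simpa using this

/-- Clearing the lowest bit. -/
theorem land_pred_testBit (x : ℕ) : 0 < x → ∃ i, x.testBit i = true ∧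
    ∀ j, ((x - 1) &&& x).testBit j = true → x.testBit j = true ∧ j ≠ i := by
  induction x using Nat.strong_induction_on with
  | _ x ih =>
    intro hx
    rcases Nat.even_or_odd' x with ⟨a, rfl | rfl⟩
    · obtain ⟨i, hi, h⟩ := ih a (by omega) (by omega)
      refine ⟨i + 1, ?_, ?_⟩
      · rw [Nat.testBit_succ]; simpa using hi
      · intro j hj
        rw [Nat.testBit_and] at hj
        cases j with
        | zero => simp [Nat.testBit_zero] at hj
        | succ j =>
          simp only [Nat.testBit_succ] at hj ⊢
          have e1 : (2 * a - 1) / 2 = a - 1 := by omega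
          have e2 : 2 * a / 2 = a := by omega
          rw [e1, e2, ← Nat.testBit_and] at hj
          have := h j hj
          rw [e2]
          exact ⟨this.1, by omega⟩
    · refine ⟨0, by simp [Nat.testBit_zero], ?_⟩
      intro j hj
      rw [Nat.testBit_and] at hj
      cases j with
      | zero => simp [Nat.testBit_zero] at hj
      | succ j => simp at hj ⊢; exact hj.2

theorem exists_testBit {x : ℕ} (hx : x ≠ 0) : ∃ i, x.testBit i = true := by
  by_contra! h
  exact hx (Nat.eq_of_testBit_eq (fun i => by simpa using h i))

theorem le2_of {x : ℕ} (h : ∀ i j k, x.testBit i = true → x.testBit j = true →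
    x.testBit k = true → i ≠ j → i ≠ k → j ≠ k → False) : le2 x = true := by
  cases x with
  | zero => rfl
  | succ n =>
    show (Nat.rec true (fun k _ => Nat.beq (Nat.land k (Nat.succ k)) 0)
      (Nat.land n (Nat.succ n)) : Bool) = true
    obtain ⟨i, hi, h1⟩ := land_pred_testBit (n + 1) (by omega)
    generalize hy : Nat.land n (Nat.succ n) = y
    have hy' : (n + 1 - 1) &&& (n + 1) = y := hy
    rw [hy'] at h1
    cases y with
    | zero => rfl
    | succ m =>
      show Nat.beq (Nat.land m (Nat.succ m)) 0 = true
      rw [beq_nat_iff]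
      obtain ⟨j, hj, h2⟩ := land_pred_testBit (m + 1) (by omega)
      by_contra hne
      obtain ⟨k, hk⟩ := exists_testBit hne
      have h3 := h2 k hk
      have h4 := h1 k h3.1
      have h5 := h1 j hj
      exact h i j k hi h5.1 h4.1 (Ne.symm h5.2) (Ne.symm h4.2) (Ne.symm h3.2)

theorem filtK_spec (p : ℕ → Bool) (l : List ℕ) : ∀ acc : List ℕ, ∃ r : List ℕ,
    (∀ k, filtK p l acc k = k r) ∧ ∀ a, a ∈ r ↔ a ∈ acc ∨ (a ∈ l ∧ p a = true) := by
  induction l with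
  | nil => intro acc; exact ⟨acc, fun k => rfl, by simp⟩
  | cons b l ih =>
    intro acc
    cases hb : p b with
    | true =>
      obtain ⟨r, h1, h2⟩ := ih (b :: acc)
      refine ⟨r, fun k => ?_, fun a => ?_⟩
      · show cnd (p b) (filtK p l (b :: acc) k) (filtK p l acc k) = _
        rw [hb, cnd_true, h1]
      · rw [h2]; simp only [List.mem_cons]
        constructor
        · rintro ((rfl | h) | h)
          · exact Or.inr ⟨Or.inl rfl, hb⟩
          · exact Or.inl h
          · exact Or.inr ⟨Or.inr h.1, h.2⟩
        · rintro (h | ⟨rfl | h, h'⟩)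
          · exact Or.inl (Or.inr h)
          · exact Or.inl (Or.inl rfl)
          · exact Or.inr ⟨h, h'⟩
    | false =>
      obtain ⟨r, h1, h2⟩ := ih acc
      refine ⟨r, fun k => ?_, fun a => ?_⟩
      · show cnd (p b) (filtK p l (b :: acc) k) (filtK p l acc k) = _
        rw [hb, cnd_false, h1]
      · rw [h2]; simp only [List.mem_cons]
        constructor
        · rintro (h | h)
          · exact Or.inl h
          · exact Or.inr ⟨Or.inr h.1, h.2⟩
        · rintro (h | ⟨rfl | h, h'⟩)
          · exact Or.inl h
          · rw [hb] at h'; cases h'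
          · exact Or.inr ⟨h, h'⟩

theorem filtAllK_spec (p : ℕ → ℕ → Bool) (cs : List ℕ) : ∀ l : List ℕ, ∃ r : List ℕ,
    (∀ k, filtAllK p cs l k = k r) ∧
      ∀ a, a ∈ r ↔ a ∈ l ∧ ∀ c ∈ cs, p c a = true := by
  induction cs with
  | nil => intro l; exact ⟨l, fun k => rfl, by simp⟩
  | cons c cs ih =>
    intro l
    obtain ⟨r, h1, h2⟩ := filtK_spec (p c) l []
    obtain ⟨r', h3, h4⟩ := ih r
    refine ⟨r', fun k => ?_, fun a => ?_⟩
    · show filtK (p c) l [] (fun l' => filtAllK p cs l' k) = _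
      rw [h1, h3]
    · rw [h4, h2]; simp; tauto

theorem allL_iff (l : List ℕ) (p : ℕ → Bool) : allL l p = true ↔ ∀ a ∈ l, p a = true := by
  induction l with
  | nil => simp [allL]
  | cons b l ih =>
    have : allL (b :: l) p = cnd (p b) (allL l p) false := rfl
    rw [this]
    cases hb : p b <;> simp [cnd, hb, ih]

theorem cover_testBit (P : ℕ) (l : List ℕ) (i : ℕ) : (cover P l).testBit i = true ↔
    P.testBit i = true ∨ ∃ c ∈ l, has c P = true ∧ c.testBit i = true := by
  induction l with
  | nil => simp [cover]
  | cons b l ih =>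
    have : cover P (b :: l) = cnd (has b P) (Nat.lor b (cover P l)) (cover P l) := rfl
    rw [this]
    cases hb : has b P
    · simp [cnd, hb, ih]
    · have e : cnd true (Nat.lor b (cover P l)) (cover P l) = b ||| cover P l := rfl
      rw [e, Nat.testBit_or]
      simp [hb, ih]; tauto

/-- Projective planes of order `q` as families of bit masks. -/
structure MP (n q : ℕ) (S : ℕ → Prop) : Prop where
  lt : ∀ c, S c → c < 2 ^ n
  card : ∀ c, S c → (bits n c).card = q + 1
  ex : ∀ i j, i < n → j < n → i ≠ j → ∃ c, S c ∧ c.testBit i = true ∧ c.testBit j = true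
  meet : ∀ c d, S c → S d → c ≠ d → ∃ i, c &&& d = 2 ^ i

theorem MP.meet_eq {n q : ℕ} {S : ℕ → Prop} (hS : MP n q S) {c d p : ℕ} (hc : S c) (hd : S d)
    (hne : c ≠ d) (hcp : c.testBit p = true) (hdp : d.testBit p = true) : c &&& d = 2 ^ p := by
  obtain ⟨i, hi⟩ := hS.meet c d hc hd hne
  have := congrArg (fun x => x.testBit p) hi
  simp [Nat.testBit_and, hcp, hdp, Nat.testBit_two_pow] at this
  rw [hi, this]

theorem MP.uniq {n q : ℕ} {S : ℕ → Prop} (hS : MP n q S) {c d i j : ℕ} (hc : S c) (hd : S d)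
    (hij : i ≠ j) (hci : c.testBit i = true) (hdi : d.testBit i = true)
    (hcj : c.testBit j = true) (hdj : d.testBit j = true) : c = d := by
  by_contra hne
  have h := hS.meet_eq hc hd hne hci hdi
  have := congrArg (fun x => x.testBit j) h
  simp [Nat.testBit_and, hcj, hdj, Nat.testBit_two_pow] at this
  exact hij this

theorem pencil_sound {n q : ℕ} {S : ℕ → Prop} (hS : MP n q S) {p : ℕ} (hp : p < n)
    (k : List ℕ → Bool) (js : List ℕ) (hjs : ∀ j ∈ js, ∃ i < n, j = 2 ^ i) :
    ∀ (cand : List ℕ) (cov : ℕ) (new : List ℕ),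
    (∀ d, S d → d.testBit p = true → d ∈ cand ∨ ∀ i, d.testBit i = true → cov.testBit i = true) →
    (∀ c ∈ new, S c) → cov.testBit p = true → pencil (2 ^ p) js cand cov new k = true →
    ∃ new', k new' = true ∧ ∀ c ∈ new', S c := by
  induction js with
  | nil => intro cand cov new _ h2 _ h; exact ⟨new, h, h2⟩
  | cons j js ih =>
    intro cand cov new h1 h2 h3 h
    have ih := ih (fun j hj => hjs j (List.mem_cons_of_mem _ hj))
    obtain ⟨i, hi, rfl⟩ := hjs j List.mem_cons_self
    change cnd (has cov (2 ^ i)) (pencil (2 ^ p) js cand cov new k)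
      (allL cand (fun c => cnd (has c (2 ^ i))
        (filtK (fun d => Nat.beq (Nat.land d c) (2 ^ p)) cand []
          (fun cand' => pencil (2 ^ p) js cand' (Nat.lor cov c) (List.cons c new) k)) true))
        = true at h
    cases hh : has cov (2 ^ i) with
    | true => rw [hh, cnd_true] at h; exact ih cand cov new h1 h2 h3 h
    | false =>
      rw [hh, cnd_false, allL_iff] at h
      have hcov : ¬ cov.testBit i = true := by rw [← has_two_pow, hh]; simp
      have hpi : p ≠ i := by rintro rfl; exact hcov h3
      obtain ⟨c, hc, hcp, hci⟩ := hS.ex p i hp hi hpi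
      have hcc : c ∈ cand := by
        rcases h1 c hc hcp with h' | h'
        · exact h'
        · exact absurd (h' i hci) hcov
      have h := h c hcc
      rw [has_two_pow.2 hci, cnd_true] at h
      obtain ⟨r, hr1, hr2⟩ := filtK_spec (fun d => Nat.beq (Nat.land d c) (2 ^ p)) cand []
      rw [hr1] at h
      refine ih r (cov ||| c) (c :: new) ?_ ?_ ?_ h
      · intro d hd hdp
        rcases h1 d hd hdp with h' | h'
        · by_cases hdc : d = c
          · right; subst hdc; intro i hi; rw [Nat.testBit_or, hi]; simp
          · left
            rw [hr2]
            exact Or.inr ⟨h', beq_nat_iff.2 (hS.meet_eq hd hc hdc hdp hcp)⟩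
        · right; intro i hi; rw [Nat.testBit_or, h' i hi]; simp
      · intro d hd
        rcases List.mem_cons.1 hd with rfl | hd
        · exact hc
        · exact h2 d hd
      · rw [Nat.testBit_or, h3]; simp

theorem levels_sound {n q : ℕ} {S : ℕ → Prop} (hS : MP n q S)
    (js : List ℕ) (hjs : ∀ j ∈ js, ∃ i < n, j = 2 ^ i) (kf : List ℕ → List ℕ → Bool)
    (bs : List (ℕ × List ℕ))
    (hbs : ∀ b ∈ bs, ∃ p < n, b.1 = 2 ^ p ∧ ∀ d, S d → d.testBit p = true → d ∈ b.2) :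
    ∀ (chosen a3 : List ℕ), (∀ c ∈ chosen, S c) →
    (∃ t ∈ a3, ∀ c, S c → le2 (Nat.land c t) = true) →
    levels js kf bs chosen a3 = true →
    ∃ chosen' a3', kf chosen' a3' = true ∧ (∀ c ∈ chosen', S c) ∧
      ∀ t ∈ a3, (∀ c, S c → le2 (Nat.land c t) = true) → t ∈ a3' := by
  induction bs with
  | nil => intro chosen a3 h1 _ h; exact ⟨chosen, a3, h, h1, fun t ht _ => ht⟩
  | cons b bs ih =>
    intro chosen a3 h1 h2 h
    have ih := ih (fun b hb => hbs b (List.mem_cons_of_mem _ hb))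
    obtain ⟨P, l⟩ := b
    obtain ⟨p, hp, hP, hl⟩ := hbs (P, l) List.mem_cons_self
    change P = 2 ^ p at hP
    subst hP
    change filtAllK (fun c d => cnd (one (Nat.land c d)) true (Nat.beq c d)) chosen l (fun cand =>
       pencil (2 ^ p) js cand (cover (2 ^ p) chosen) List.nil (fun new =>
         filtAllK (fun c d => le2 (Nat.land c d)) new a3 (fun a3' =>
           List.rec true (fun _ _ _ => levels js kf bs (List.append new chosen) a3') a3')))
           = true at h
    obtain ⟨r, hr1, hr2⟩ := filtAllK_spec
      (fun c d => cnd (one (Nat.land c d)) true (Nat.beq c d)) chosen l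
    rw [hr1] at h
    obtain ⟨new, hn1, hn2⟩ := pencil_sound hS hp _ js hjs r _ [] (by
      intro d hd hdp
      left
      rw [hr2]
      refine ⟨hl d hd hdp, fun c hc => ?_⟩
      by_cases hcd : c = d
      · subst hcd
        have : Nat.beq c c = true := Nat.beq_refl c
        rw [this]
        cases one (Nat.land c c) <;> rfl
      · obtain ⟨i, hi⟩ := hS.meet c d (h1 c hc) hd hcd
        have : one (Nat.land c d) = true := by
          rw [show Nat.land c d = 2 ^ i from hi]; exact one_two_pow i
        rw [this, cnd_true]) (by simp) (by
      rw [cover_testBit]; left; exact Nat.testBit_two_pow_self) h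
    obtain ⟨a, ha1, ha2⟩ := filtAllK_spec (fun c d => le2 (Nat.land c d)) new a3
    simp only [ha1] at hn1
    have key : ∀ t ∈ a3, (∀ c, S c → le2 (Nat.land c t) = true) → t ∈ a := by
      intro t ht h
      rw [ha2]
      exact ⟨ht, fun c hc => h c (hn2 c hc)⟩
    obtain ⟨t, ht, ht'⟩ := h2
    have hta := key t ht ht'
    cases a with
    | nil => simp at hta
    | cons a0 a =>
      obtain ⟨ch, a3', e1, e2, e3⟩ := ih (List.append new chosen) (a0 :: a) (by
        intro c hc
        rcases List.mem_append.1 hc with hc | hc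
        · exact hn2 c hc
        · exact h1 c hc) ⟨t, hta, ht'⟩ hn1
      exact ⟨ch, a3', e1, e2, fun t ht h => e3 t (key t ht h) h⟩

theorem remK_spec (t cur : ℕ) (ls : List ℕ) : ∀ al : ℕ, ∃ al', (∀ k, remK t cur ls al k = k al') ∧
    (∀ j, al.testBit j = true → (∀ l ∈ ls, t ||| (l &&& cur) ≠ 0 → l.testBit j = false) →
      al'.testBit j = true) ∧ ∀ j, al'.testBit j = true → al.testBit j = true := by
  induction ls with
  | nil => intro al; exact ⟨al, fun k => rfl, fun j h _ => h, fun j h => h⟩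
  | cons l ls ih =>
    intro al
    have e : ∀ k, remK t cur (l :: ls) al k = Nat.rec (remK t cur ls al k)
      (fun _ _ => Nat.rec (remK t cur ls 0 k) (fun n _ => remK t cur ls (Nat.succ n) k)
        (Nat.xor al (Nat.land al l))) (Nat.lor t (Nat.land l cur)) := fun k => rfl
    cases hx : Nat.lor t (Nat.land l cur) with
    | zero =>
      obtain ⟨al', h1, h2, h3⟩ := ih al
      refine ⟨al', fun k => ?_, fun j hj h => h2 j hj (fun l hl => h l (List.mem_cons_of_mem _ hl)), ?_⟩
      · rw [e, hx]; exact h1 k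
      · exact h3
    | succ x =>
      obtain ⟨al', h1, h2, h3⟩ := ih (al ^^^ (al &&& l))
      refine ⟨al', fun k => ?_, fun j hj h => h2 j ?_ (fun l hl => h l (List.mem_cons_of_mem _ hl)), ?_⟩
      · rw [e, hx]
        have e2 : ∀ y, (Nat.rec (remK t cur ls 0 k)
          (fun n _ => remK t cur ls (Nat.succ n) k) y : Bool) = remK t cur ls y k := by
          intro y; cases y <;> rfl
        show (Nat.rec (remK t cur ls 0 k) (fun n _ => remK t cur ls (Nat.succ n) k)
          (Nat.xor al (Nat.land al l)) : Bool) = _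
        rw [e2]; exact h1 k
      · have := h l List.mem_cons_self (by
          rw [show t ||| (l &&& cur) = x + 1 from hx]; omega)
        simp [hj, this]
      · intro j hj
        have := h3 j hj
        rw [Nat.testBit_xor, Nat.testBit_and] at this
        cases hh : al.testBit j
        · rw [hh] at this; simp at this
        · rfl

theorem eq_of_card {n c cur : ℕ} (hcn : c < 2 ^ n)
    (h1 : ∀ i, cur.testBit i = true → c.testBit i = true)
    (h3 : ((bits n c) \ (bits n cur)).card = 0) : c = cur := by
  apply Nat.eq_of_testBit_eq
  intro i
  rw [Finset.card_eq_zero, Finset.sdiff_eq_empty_iff_subset] at h3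
  rw [Bool.eq_iff_iff]
  refine ⟨fun hc => ?_, h1 i⟩
  have hin : i < n := by
    by_contra hin
    rw [Nat.testBit_lt_two_pow (lt_of_lt_of_le hcn
      (Nat.pow_le_pow_right (by norm_num) (not_lt.1 hin)))] at hc
    cases hc
  exact (mem_bits.1 (h3 (mem_bits.2 ⟨hin, hc⟩))).2

theorem gen_spec (t n : ℕ) (Q : ℕ → Prop) (pts : List (ℕ × List ℕ))
    (hp : ∀ b ∈ pts, ∃ i < n, b.1 = 2 ^ i) (hnd : (pts.map Prod.fst).Nodup)
    (H : ∀ c, Q c → ∀ b ∈ pts, ∀ l ∈ b.2, ∀ cur i j, b.1 = 2 ^ i → c.testBit i = true →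
      (∀ i, cur.testBit i = true → c.testBit i = true) → cur.testBit i = false →
      t ||| (l &&& cur) ≠ 0 → c.testBit j = true → cur.testBit j = false → j ≠ i →
      l.testBit j = false) :
    ∀ (need cur al : ℕ) (acc : List ℕ), (∀ b ∈ pts, has al b.1 = true → has cur b.1 = false) →
    ∃ r, (∀ k, gen t pts need cur al acc k = k r) ∧ (∀ a ∈ acc, a ∈ r) ∧
      ∀ c, Q c → c < 2 ^ n → (∀ i, cur.testBit i = true → c.testBit i = true) →
        (∀ i, c.testBit i = true → cur.testBit i = true ∨
          (al.testBit i = true ∧ ∃ b ∈ pts, b.1 = 2 ^ i)) →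
        ((bits n c) \ (bits n cur)).card = need → c ∈ r := by
  induction pts with
  | nil =>
    intro need cur al acc _
    cases need with
    | zero =>
      refine ⟨cur :: acc, fun k => rfl, fun a ha => List.mem_cons_of_mem _ ha, ?_⟩
      intro c _ hcn h1 _ h3
      rw [eq_of_card hcn h1 h3]; exact List.mem_cons_self
    | succ need =>
      refine ⟨acc, fun k => rfl, fun a ha => ha, ?_⟩
      intro c _ _ _ h2 h3
      exfalso
      have : (bits n c) \ (bits n cur) = ∅ := by
        rw [Finset.sdiff_eq_empty_iff_subset]
        intro i hi
        rw [mem_bits] at hi ⊢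
        rcases h2 i hi.2 with h | ⟨_, b, hb, _⟩
        · exact ⟨hi.1, h⟩
        · cases hb
      rw [this] at h3; simp at h3
  | cons b pts ih =>
    intro need cur al acc hcur
    obtain ⟨B, ls⟩ := b
    obtain ⟨i, hi, hB⟩ := hp (B, ls) List.mem_cons_self
    change B = 2 ^ i at hB
    subst hB
    simp only [List.map_cons, List.nodup_cons] at hnd
    have ih := ih (fun b hb => hp b (List.mem_cons_of_mem _ hb)) hnd.2
      (fun c hc b hb => H c hc b (List.mem_cons_of_mem _ hb))
    have e : ∀ need k, gen t ((2 ^ i, ls) :: pts) need cur al acc k =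
      Nat.rec (k (List.cons cur acc)) (fun need' _ =>
      cnd (has al (2 ^ i))
       (remK t cur ls al (fun al' => gen t pts need' (Nat.lor cur (2 ^ i)) al' acc
          (fun acc' => gen t pts (Nat.succ need') cur al acc' k)))
       (gen t pts (Nat.succ need') cur al acc k)) need := fun need k => rfl
    cases need with
    | zero =>
      refine ⟨cur :: acc, fun k => rfl, fun a ha => List.mem_cons_of_mem _ ha, ?_⟩
      intro c _ hcn h1 _ h3
      rw [eq_of_card hcn h1 h3]; exact List.mem_cons_self
    | succ need' =>
      have hskip : ∀ b ∈ pts, has al b.1 = true → has cur b.1 = false := fun b hb => hcur b (List.mem_cons_of_mem _ hb)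
      cases hal : has al (2 ^ i) with
      | false =>
        obtain ⟨r, hr1, hr2, hr3⟩ := ih (need' + 1) cur al acc hskip
        refine ⟨r, fun k => ?_, hr2, ?_⟩
        · rw [e, ← hr1 k]; simp only [hal, cnd_false]
        · intro c hc hcn h1 h2 h3
          refine hr3 c hc hcn h1 ?_ h3
          intro j hj
          rcases h2 j hj with h | ⟨h, b, hb, hbj⟩
          · exact Or.inl h
          · right
            refine ⟨h, ?_⟩
            rcases List.mem_cons.1 hb with rfl | hb
            · have hij : i = j := Nat.pow_right_injective (le_refl 2) hbj
              subst hij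
              rw [← has_two_pow, hal] at h
              cases h
            · exact ⟨b, hb, hbj⟩
      | true =>
        have hci : cur.testBit i = false := by
          have := hcur _ List.mem_cons_self hal
          rw [← Bool.not_eq_true, ← has_two_pow]; simpa using this
        obtain ⟨al', ha1, ha2, ha3⟩ := remK_spec t cur ls al
        have hnext : ∀ b ∈ pts, has al' b.1 = true → has (cur ||| 2 ^ i) b.1 = false := by
          intro b hb hab
          obtain ⟨j, hj, hbj⟩ := hp b (List.mem_cons_of_mem _ hb)
          have h1 := hskip b hb (by
            rw [hbj, has_two_pow] at hab ⊢; exact ha3 j hab)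
          rw [hbj] at h1 ⊢
          rw [← Bool.not_eq_true, has_two_pow] at h1 ⊢
          rw [Nat.testBit_or, Nat.testBit_two_pow]
          have : i ≠ j := by
            rintro rfl
            exact hnd.1 (List.mem_map.2 ⟨b, hb, hbj⟩)
          simp [h1, this]
        obtain ⟨r0, hr1, hr2, hr3⟩ := ih need' (cur ||| 2 ^ i) al' acc hnext
        obtain ⟨r, hs1, hs2, hs3⟩ := ih (need' + 1) cur al r0 hskip
        refine ⟨r, fun k => ?_, fun a ha => hs2 a (hr2 a ha), ?_⟩
        · rw [e]
          simp only [hal, cnd_true, ha1]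
          rw [← hs1 k]
          exact hr1 _
        · intro c hc hcn h1 h2 h3
          by_cases hcb : c.testBit i = true
          · apply hs2
            refine hr3 c hc hcn ?_ ?_ ?_
            · intro j hj
              rw [Nat.testBit_or, Nat.testBit_two_pow] at hj
              simp only [Bool.or_eq_true, decide_eq_true_eq] at hj
              rcases hj with hj | rfl
              · exact h1 j hj
              · exact hcb
            · intro j hj
              by_cases hij : j = i
              · left; subst hij; simp [Nat.testBit_or, Nat.testBit_two_pow_self]
              · rcases h2 j hj with h | ⟨h, b, hb, hbj⟩
                · left; simp [Nat.testBit_or, h]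
                · by_cases hcj : cur.testBit j = true
                  · left; simp [Nat.testBit_or, hcj]
                  right
                  refine ⟨ha2 j h ?_, ?_⟩
                  · intro l hl hne
                    exact H c hc (2 ^ i, ls) List.mem_cons_self l hl cur i j rfl hcb h1 hci hne hj
                      (by simpa using hcj) hij
                  · rcases List.mem_cons.1 hb with rfl | hb
                    · exact absurd (Nat.pow_right_injective (le_refl 2) hbj).symm hij
                    · exact ⟨b, hb, hbj⟩
            · have : bits n c \ bits n (cur ||| 2 ^ i) = (bits n c \ bits n cur).erase i := by
                ext j
                simp only [Finset.mem_sdiff, mem_bits, Finset.mem_erase, Nat.testBit_or,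
                  Nat.testBit_two_pow, Bool.or_eq_true, decide_eq_true_eq]
                constructor
                · rintro ⟨⟨a, b⟩, c⟩
                  exact ⟨fun h => c ⟨a, Or.inr h.symm⟩, ⟨a, b⟩, fun h => c ⟨a, Or.inl h.2⟩⟩
                · rintro ⟨a, ⟨b, c⟩, d⟩
                  refine ⟨⟨b, c⟩, ?_⟩
                  rintro ⟨_, h | h⟩
                  · exact d ⟨b, h⟩
                  · exact a h.symm
              rw [this, Finset.card_erase_of_mem, h3]
              · rfl
              · simp [mem_bits, hi, hcb, hci]
          · refine hs3 c hc hcn h1 ?_ h3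
            intro j hj
            rcases h2 j hj with h | ⟨h, b, hb, hbj⟩
            · exact Or.inl h
            · right
              refine ⟨h, ?_⟩
              rcases List.mem_cons.1 hb with rfl | hb
              · have : i = j := Nat.pow_right_injective (le_refl 2) hbj
                subst this; exact absurd hj hcb
              · exact ⟨b, hb, hbj⟩

/-- A complete list of points together with some of the lines through each of them. -/
structure Pts (n : ℕ) (lines : List ℕ) (pts : List (ℕ × List ℕ)) : Prop where
  pow : ∀ b ∈ pts, ∃ i < n, b.1 = 2 ^ i
  nodup : (pts.map Prod.fst).Nodup
  full : ∀ i < n, ∃ b ∈ pts, b.1 = 2 ^ i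
  ls : ∀ b ∈ pts, ∀ l ∈ b.2, l ∈ lines ∧ has l b.1 = true

theorem ptsK_spec (lines js : List ℕ) : ∀ acc : List (ℕ × List ℕ), ∃ r,
    (∀ k, ptsK lines js acc k = k r) ∧ r.map Prod.fst = js.reverse ++ acc.map Prod.fst ∧
    ∀ b ∈ r, b ∈ acc ∨ ∀ l ∈ b.2, l ∈ lines ∧ has l b.1 = true := by
  induction js with
  | nil => intro acc; exact ⟨acc, fun k => rfl, by simp, fun b hb => Or.inl hb⟩
  | cons j js ih =>
    intro acc
    obtain ⟨ls, h1, h2⟩ := filtK_spec (fun l => has l j) lines []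
    obtain ⟨r, h3, h4, h5⟩ := ih ((j, ls) :: acc)
    refine ⟨r, fun k => ?_, ?_, ?_⟩
    · show filtK (fun l => has l j) lines [] (fun ls => ptsK lines js ((j, ls) :: acc) k) = _
      rw [h1, h3]
    · rw [h4]; simp
    · intro b hb
      rcases h5 b hb with h | h
      · rcases List.mem_cons.1 h with rfl | h
        · right; intro l hl
          rw [h2] at hl; simpa using hl
        · exact Or.inl h
      · exact Or.inr h

/-- An enumeration of all points. -/
def JS (n : ℕ) (js : List ℕ) : Prop :=
  js.Nodup ∧ (∀ j ∈ js, ∃ i < n, j = 2 ^ i) ∧ ∀ i < n, 2 ^ i ∈ js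

theorem ptsK_Pts {n : ℕ} (lines : List ℕ) {js : List ℕ} (h : JS n js) : ∃ r,
    (∀ k, ptsK lines js [] k = k r) ∧ Pts n lines r := by
  obtain ⟨r, h1, h2, h3⟩ := ptsK_spec lines js []
  simp only [List.map_nil, List.append_nil] at h2
  refine ⟨r, h1, ⟨?_, ?_, ?_, ?_⟩⟩
  · intro b hb
    have : b.1 ∈ r.map Prod.fst := List.mem_map_of_mem hb
    rw [h2, List.mem_reverse] at this
    exact h.2.1 _ this
  · rw [h2, List.nodup_reverse]; exact h.1
  · intro i hi
    have : 2 ^ i ∈ r.map Prod.fst := by rw [h2, List.mem_reverse]; exact h.2.2 i hi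
    obtain ⟨b, hb, hb'⟩ := List.mem_map.1 this
    exact ⟨b, hb, hb'⟩
  · intro b hb
    rcases h3 b hb with h | h
    · cases h
    · exact h

/-- Validity of the pruning rule. -/
def HQ (t : ℕ) (lines : List ℕ) (Q : ℕ → Prop) : Prop :=
  ∀ c, Q c → ∀ l ∈ lines, ∀ cur i j, l.testBit i = true → c.testBit i = true →
      (∀ i, cur.testBit i = true → c.testBit i = true) → cur.testBit i = false →
      t ||| (l &&& cur) ≠ 0 → c.testBit j = true → cur.testBit j = false → j ≠ i →
      l.testBit j = false

/-- `c` and `d` do not have three common bits. -/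
def Ov (c d : ℕ) : Prop := ∀ i j k, c.testBit i = true → d.testBit i = true →
  c.testBit j = true → d.testBit j = true → c.testBit k = true → d.testBit k = true →
  i ≠ j → i ≠ k → j ≠ k → False

theorem Ov.le2 {c d : ℕ} (h : Ov c d) : le2 (Nat.land c d) = true := by
  apply le2_of
  intro i j k hi hj hk
  rw [show Nat.land c d = c &&& d from rfl, Nat.testBit_and, Bool.and_eq_true] at hi hj hk
  exact h i j k hi.1 hi.2 hj.1 hj.2 hk.1 hk.2

theorem Ov.symm {c d : ℕ} (h : Ov c d) : Ov d c :=
  fun i j k a b c d e f => h i j k b a d c f e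

theorem HQ_zero {lines : List ℕ} {Q : ℕ → Prop} (h : ∀ c, Q c → ∀ l ∈ lines, Ov l c) :
    HQ 0 lines Q := by
  intro c hc l hl cur i j hli hci hcur hcuri hne hcj hcurj hji
  rw [Nat.zero_or] at hne
  obtain ⟨s, hs⟩ := exists_testBit hne
  rw [Nat.testBit_and, Bool.and_eq_true] at hs
  by_contra hlj
  rw [Bool.not_eq_false] at hlj
  refine h c hc l hl i j s hli hci hlj hcj hs.1 (hcur s hs.2) hji.symm ?_ ?_
  · rintro rfl; rw [hs.2] at hcuri; cases hcuri
  · rintro rfl; rw [hs.2] at hcurj; cases hcurj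

theorem HQ_one {n q : ℕ} {S : ℕ → Prop} (hS : MP n q S) {known : List ℕ}
    (hk : ∀ c ∈ known, S c) : HQ 1 known (fun c => S c ∧ c ∉ known) := by
  intro c hc l hl cur i j hli hci hcur hcuri hne hcj hcurj hji
  by_contra hlj
  rw [Bool.not_eq_false] at hlj
  have := hS.uniq hc.1 (hk l hl) hji.symm hci hli hcj hlj
  exact hc.2 (this ▸ hl)

theorem gen_Pts {t n : ℕ} {lines : List ℕ} {Q : ℕ → Prop} {pts : List (ℕ × List ℕ)}
    (hP : Pts n lines pts) (H : HQ t lines Q) (need cur al : ℕ) (acc : List ℕ)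
    (hal : ∀ i, al.testBit i = true → cur.testBit i = false) :
    ∃ r, (∀ k, gen t pts need cur al acc k = k r) ∧ (∀ a ∈ acc, a ∈ r) ∧
      ∀ c, Q c → c < 2 ^ n → (∀ i, cur.testBit i = true → c.testBit i = true) →
        (∀ i, c.testBit i = true → cur.testBit i = true ∨ al.testBit i = true) →
        ((bits n c) \ (bits n cur)).card = need → c ∈ r := by
  obtain ⟨r, h1, h2, h3⟩ := gen_spec t n Q pts hP.pow hP.nodup (by
    intro c hc b hb l hl cur i j hbi hci hcur hcuri hne hcj hcurj hji
    have := hP.ls b hb l hl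
    rw [hbi, has_two_pow] at this
    exact H c hc l this.1 cur i j this.2 hci hcur hcuri hne hcj hcurj hji) need cur al acc (by
    intro b hb h
    obtain ⟨i, hi, hbi⟩ := hP.pow b hb
    rw [hbi] at h ⊢
    rw [has_two_pow] at h
    rw [← Bool.not_eq_true, has_two_pow, hal i h]; simp)
  refine ⟨r, h1, h2, fun c hc hcn e1 e2 e3 => h3 c hc hcn e1 ?_ e3⟩
  intro i hi
  rcases e2 i hi with h | h
  · exact Or.inl h
  · exact Or.inr ⟨h, hP.full i (by
      by_contra hin
      rw [Nat.testBit_lt_two_pow (lt_of_lt_of_le hcn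
        (Nat.pow_le_pow_right (by norm_num) (not_lt.1 hin)))] at hi
      cases hi)⟩

theorem lt_of_testBit {n c i : ℕ} (hcn : c < 2 ^ n) (hi : c.testBit i = true) : i < n := by
  by_contra hin
  rw [Nat.testBit_lt_two_pow (lt_of_lt_of_le hcn
    (Nat.pow_le_pow_right (by norm_num) (not_lt.1 hin)))] at hi
  cases hi

theorem bucketsK_spec {t n q : ℕ} {S : ℕ → Prop} (hS : MP n q S) {lines known : List ℕ}
    (hk : ∀ c ∈ known, S c) (H : HQ t lines (fun c => S c ∧ c ∉ known))
    {pts : List (ℕ × List ℕ)} (hP : Pts n lines pts) (ps : List ℕ)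
    (hps : ∀ P ∈ ps, ∃ p < n, P = 2 ^ p) : ∀ acc : List (ℕ × List ℕ),
    (∀ b ∈ acc, ∃ p < n, b.1 = 2 ^ p ∧ ∀ d, S d → d.testBit p = true → d ∈ b.2) →
    ∃ bs, (∀ k, bucketsK t q (2 ^ n - 1) pts known ps acc k = k bs) ∧
      ∀ b ∈ bs, ∃ p < n, b.1 = 2 ^ p ∧ ∀ d, S d → d.testBit p = true → d ∈ b.2 := by
  induction ps with
  | nil => intro acc h; exact ⟨acc, fun k => rfl, h⟩
  | cons P ps ih =>
    intro acc hacc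
    have ih := ih (fun b hb => hps b (List.mem_cons_of_mem _ hb))
    obtain ⟨p, hp, rfl⟩ := hps P List.mem_cons_self
    obtain ⟨ks, h1, h2⟩ := filtK_spec (fun l => has l (2 ^ p)) known []
    have hcov : ∀ i, (Nat.xor (2 ^ n - 1) (cover (2 ^ p) known)).testBit i =
        ((decide (i < n)) ^^ (cover (2 ^ p) known).testBit i) := by
      intro i
      rw [show Nat.xor (2 ^ n - 1) (cover (2 ^ p) known) =
        (2 ^ n - 1) ^^^ (cover (2 ^ p) known) from rfl, Nat.testBit_xor,
        Nat.testBit_two_pow_sub_one]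
    have hcovlt : ∀ i, (cover (2 ^ p) known).testBit i = true → i < n := by
      intro i hi
      rw [cover_testBit] at hi
      rcases hi with hi | ⟨c, hc, _, hi⟩
      · rw [Nat.testBit_two_pow] at hi; simp at hi; omega
      · exact lt_of_testBit (hS.lt c (hk c hc)) hi
    obtain ⟨l, h3, h4, h5⟩ := gen_Pts hP H q (2 ^ p)
      (Nat.xor (2 ^ n - 1) (cover (2 ^ p) known)) ks (by
      intro i hi
      by_contra h
      rw [Bool.not_eq_false] at h
      have h' : (cover (2 ^ p) known).testBit i = true := by
        rw [cover_testBit]; exact Or.inl h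
      rw [hcov, h'] at hi
      simp [hcovlt i h'] at hi)
    obtain ⟨bs, h6, h7⟩ := ih ((2 ^ p, l) :: acc) (by
      intro b hb
      rcases List.mem_cons.1 hb with rfl | hb
      · refine ⟨p, hp, rfl, fun d hd hdp => ?_⟩
        by_cases hdk : d ∈ known
        · apply h4; rw [h2]; exact Or.inr ⟨hdk, has_two_pow.2 hdp⟩
        · refine h5 d ⟨hd, hdk⟩ (hS.lt d hd) ?_ ?_ ?_
          · intro i hi; rw [Nat.testBit_two_pow] at hi; simp at hi; rwa [← hi]
          · intro i hi
            by_cases hip : p = i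
            · left; rw [hip]; exact Nat.testBit_two_pow_self
            · right
              rw [hcov]
              have : (cover (2 ^ p) known).testBit i = false := by
                by_contra h
                rw [Bool.not_eq_false, cover_testBit] at h
                rcases h with h | ⟨c, hc, hcp, hci⟩
                · rw [Nat.testBit_two_pow] at h; simp at h; exact hip h
                · rw [has_two_pow] at hcp
                  exact hdk (hS.uniq hd (hk c hc) hip hdp hcp hi hci ▸ hc)
              rw [this]; simp [lt_of_testBit (hS.lt d hd) hi]
          · have e : bits n (2 ^ p) = {p} := by
              ext i; rw [mem_bits, Nat.testBit_two_pow]; simp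
              constructor
              · rintro ⟨_, h⟩; exact h.symm
              · rintro rfl; exact ⟨hp, rfl⟩
            rw [e, Finset.sdiff_singleton_eq_erase, Finset.card_erase_of_mem, hS.card d hd]
            · rfl
            · exact mem_bits.2 ⟨hp, hdp⟩
      · exact hacc b hb)
    refine ⟨bs, fun k => ?_, h7⟩
    show filtK (fun l => has l (2 ^ p)) known [] (fun ks =>
      gen t pts q (2 ^ p) (Nat.xor (2 ^ n - 1) (cover (2 ^ p) known)) ks
        (fun l => bucketsK t q (2 ^ n - 1) pts known ps (List.cons (2 ^ p, l) acc) k)) = _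
    rw [h1, h3, h6]

/-! ### The three checks -/

/-- Some member of the list satisfies `p`. -/
noncomputable def anyL {α : Type} (l : List α) (p : α → Bool) : Bool :=
  List.rec false (fun a _ ih => cnd (p a) true ih) l

theorem anyL_true {α : Type} (l : List α) (p : α → Bool) (h : anyL l p = true) :
    ∃ a ∈ l, p a = true := by
  induction l with
  | nil => cases h
  | cons b l ih =>
    change cnd (p b) true (anyL l p) = true at h
    cases hb : p b with
    | true => exact ⟨b, List.mem_cons_self, hb⟩
    | false =>
      rw [hb, cnd_false] at h
      obtain ⟨a, ha, h⟩ := ih h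
      exact ⟨a, List.mem_cons_of_mem _ ha, h⟩

/-- Find all planes containing the known lines. -/
noncomputable def check1 (q full : ℕ) (known js slopes : List ℕ)
    (imgs : List (List ℕ × List ℕ)) : Bool :=
  ptsK known js [] fun pts => bucketsK 1 q full pts known slopes [] fun bs =>
    levels js (fun chosen _ => anyL imgs fun im => allL im.2 fun s =>
      anyL chosen fun c => Nat.beq c s) bs known [0]

theorem check1_sound {n q : ℕ} {S : ℕ → Prop} (hS : MP n q S) {known js slopes : List ℕ}
    {imgs : List (List ℕ × List ℕ)} (hjs : JS n js) (hsl : ∀ P ∈ slopes, ∃ p < n, P = 2 ^ p)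
    (hk : ∀ c ∈ known, S c) (h : check1 q (2 ^ n - 1) known js slopes imgs = true) :
    ∃ im ∈ imgs, ∀ s ∈ im.2, S s := by
  unfold check1 at h
  obtain ⟨pts, h1, hP⟩ := ptsK_Pts known hjs
  rw [h1] at h
  obtain ⟨bs, h2, hbs⟩ := bucketsK_spec hS hk (HQ_one hS hk) hP slopes hsl [] (by simp)
  rw [h2] at h
  obtain ⟨ch, a3, h3, h4, -⟩ := levels_sound hS js hjs.2.1 _ bs hbs known [0] hk
    ⟨0, by simp, fun c _ => by rw [show Nat.land c 0 = 0 from Nat.and_zero c]; rfl⟩ h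
  obtain ⟨im, him, h5⟩ := anyL_true _ _ h3
  refine ⟨im, him, fun s hs => ?_⟩
  rw [allL_iff] at h5
  obtain ⟨c, hc, h6⟩ := anyL_true _ _ (h5 s hs)
  rw [beq_nat_iff] at h6
  exact h6 ▸ h4 c hc

/-- Find all ovals containing a frame. -/
noncomputable def check2 (need full frame : ℕ) (std js : List ℕ)
    (imgs : List (List ℕ × ℕ)) : Bool :=
  ptsK std js [] fun pts => gen 0 pts need frame (Nat.xor full frame) [] fun r =>
    filtAllK (fun c d => le2 (Nat.land c d)) std r fun r' =>
      allL r' fun m => anyL imgs fun im => Nat.beq im.2 m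

theorem xor_full {n m i : ℕ} (h : m < 2 ^ n) :
    (Nat.xor (2 ^ n - 1) m).testBit i = true ↔ i < n ∧ m.testBit i = false := by
  rw [show Nat.xor (2 ^ n - 1) m = (2 ^ n - 1) ^^^ m from rfl, Nat.testBit_xor,
        Nat.testBit_two_pow_sub_one]
  cases hm : m.testBit i
  · simp
  · simp [lt_of_testBit h hm]

theorem bits_subset {n c d : ℕ} (h : ∀ i, c.testBit i = true → d.testBit i = true) :
    bits n c ⊆ bits n d := by
  intro i hi
  rw [mem_bits] at hi ⊢
  exact ⟨hi.1, h i hi.2⟩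

theorem check2_sound {n need frame : ℕ} {std js : List ℕ} {imgs : List (List ℕ × ℕ)}
    (hjs : JS n js) (hf : frame < 2 ^ n) {m : ℕ} (hm : m < 2 ^ n)
    (hov : ∀ s ∈ std, Ov s m) (hfm : ∀ i, frame.testBit i = true → m.testBit i = true)
    (hc : (bits n m).card = need + (bits n frame).card)
    (h : check2 need (2 ^ n - 1) frame std js imgs = true) : ∃ im ∈ imgs, im.2 = m := by
  unfold check2 at h
  obtain ⟨pts, h1, hP⟩ := ptsK_Pts std hjs
  rw [h1] at h
  obtain ⟨r, h2, -, h3⟩ := gen_Pts (Q := fun c => ∀ s ∈ std, Ov s c) hP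
    (HQ_zero fun c hc => hc) need frame (Nat.xor (2 ^ n - 1) frame) [] (by
      intro i hi; exact ((xor_full hf).1 hi).2)
  rw [h2] at h
  obtain ⟨r', h4, h5⟩ := filtAllK_spec (fun c d => le2 (Nat.land c d)) std r
  rw [h4, allL_iff] at h
  have hmr : m ∈ r' := by
    rw [h5]
    refine ⟨h3 m hov hm hfm ?_ ?_, fun c hc => (hov c hc).le2⟩
    · intro i hi
      cases hh : frame.testBit i
      · right; exact (xor_full hf).2 ⟨lt_of_testBit hm hi, hh⟩
      · left; rfl
    · rw [Finset.card_sdiff_of_subset (bits_subset hfm), hc]; omega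
  obtain ⟨im, him, h6⟩ := anyL_true _ _ (h m hmr)
  exact ⟨im, him, beq_nat_iff.1 h6⟩

/-- No two orthogoval planes through the oval `m`. -/
noncomputable def check3 (q need full m w : ℕ) (std js centers : List ℕ) : Bool :=
  ptsK std js [] fun pts => bucketsK 0 q full pts [m] centers [] fun bs =>
    gen 0 pts need w (Nat.xor full m) [] fun r =>
      filtAllK (fun c d => le2 (Nat.land c d)) std r fun a3 =>
        levels js (fun _ _ => false) bs [m] a3

theorem check3_sound {n q need m w : ℕ} {S : ℕ → Prop} (hS : MP n q S)
    {std js centers : List ℕ} (hjs : JS n js) (hce : ∀ P ∈ centers, ∃ p < n, P = 2 ^ p)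
    (hm : S m) (hov : ∀ s ∈ std, ∀ c, S c → Ov s c)
    (hwm : ∀ i, w.testBit i = true → m.testBit i = true)
    {i₁ i₂ : ℕ} (hi₁ : w.testBit i₁ = true) (hi₂ : w.testBit i₂ = true) (hi : i₁ ≠ i₂)
    {t : ℕ} (ht : t < 2 ^ n) (hts : ∀ s ∈ std, Ov s t) (htS : ∀ c, S c → Ov c t)
    (hwt : ∀ i, w.testBit i = true → t.testBit i = true)
    (hc : (bits n t).card = need + (bits n w).card)
    (h : check3 q need (2 ^ n - 1) m w std js centers = true) : False := by
  unfold check3 at h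
  obtain ⟨pts, h1, hP⟩ := ptsK_Pts std hjs
  rw [h1] at h
  have hk : ∀ c ∈ [m], S c := by simpa using hm
  obtain ⟨bs, h2, hbs⟩ := bucketsK_spec hS hk
    (HQ_zero (Q := fun c => S c ∧ c ∉ [m]) fun c hc s hs => hov s hs c hc.1) hP centers hce []
    (by simp)
  rw [h2] at h
  have hmn := hS.lt m hm
  obtain ⟨r, h2, -, h3⟩ := gen_Pts (Q := fun c => ∀ s ∈ std, Ov s c) hP
    (HQ_zero fun c hc => hc) need w (Nat.xor (2 ^ n - 1) m) [] (by
      intro i hi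
      have := ((xor_full hmn).1 hi).2
      by_contra hh
      rw [Bool.not_eq_false] at hh
      rw [hwm i hh] at this; cases this)
  rw [h2] at h
  obtain ⟨r', h4, h5⟩ := filtAllK_spec (fun c d => le2 (Nat.land c d)) std r
  rw [h4] at h
  have hmr : t ∈ r' := by
    rw [h5]
    refine ⟨h3 t hts ht hwt ?_ ?_, fun c hc => (hts c hc).le2⟩
    · intro i hti
      cases hh : m.testBit i
      · right; exact (xor_full hmn).2 ⟨lt_of_testBit ht hti, hh⟩
      · left
        by_contra hw
        refine htS m hm i i₁ i₂ hh hti (hwm _ hi₁) (hwt _ hi₁) (hwm _ hi₂) (hwt _ hi₂) ?_ ?_ hi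
        · rintro rfl; exact hw hi₁
        · rintro rfl; exact hw hi₂
    · rw [Finset.card_sdiff_of_subset (bits_subset hwt), hc]; omega
  obtain ⟨ch, a3, h3, -, -⟩ := levels_sound hS js hjs.2.1 _ bs hbs [m] r' hk
    ⟨t, hmr, fun c hc => (htS c hc).le2⟩ h
  cases h3

/-! ### Relabelling -/

/-- Labelling of the points by the numbers below `n`. -/
structure Lab {P : Type*} (n : ℕ) (g : ℕ → P) : Prop where
  inj : ∀ i < n, ∀ j < n, g i = g j → i = j
  surj : ∀ p, ∃ i < n, g i = p

/-- The family of bit masks of the blocks. -/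
def SS {P : Type*} (L : Set (Finset P)) (n : ℕ) (g : ℕ → P) (c : ℕ) : Prop :=
  c < 2 ^ n ∧ ∃ B ∈ L, ∀ i < n, (c.testBit i = true ↔ g i ∈ B)

/-- Preimage of a mask under a permutation. -/
def pre : List ℕ → ℕ → ℕ
  | [], _ => 0
  | a :: l, d => (bif d.testBit a then 1 else 0) + 2 * pre l d

theorem pre_lt (l : List ℕ) (d : ℕ) : pre l d < 2 ^ l.length := by
  induction l with
  | nil => simp [pre]
  | cons a l ih =>
    rw [pre, List.length_cons, pow_succ]
    cases d.testBit a <;> simp only [cond_true, cond_false] <;> omega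

theorem pre_testBit (l : List ℕ) (d : ℕ) : ∀ i < l.length,
    (pre l d).testBit i = d.testBit (l.getD i 0) := by
  induction l with
  | nil => simp
  | cons a l ih =>
    intro i hi
    cases i with
    | zero =>
      rw [pre, Nat.testBit_zero, List.getD_cons_zero]
      cases d.testBit a <;> simp
    | succ i =>
      rw [pre, Nat.testBit_succ, List.getD_cons_succ, ← ih i (by simpa using hi)]
      congr 1
      cases d.testBit a <;> simp only [cond_true, cond_false] <;> omega

/-- Lists which represent permutations. -/
def Perm (n : ℕ) (l : List ℕ) : Prop :=
  l.length = n ∧ l.Nodup ∧ ∀ a ∈ l, a < n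

theorem Perm.lab {P : Type*} {n : ℕ} {l : List ℕ} (h : Perm n l) {g : ℕ → P} (hg : Lab n g) :
    Lab n (fun i => g (l.getD i 0)) := by
  obtain ⟨h1, h2, h3⟩ := h
  have hget : ∀ i (hi : i < n), l.getD i 0 = l[i]'(h1.symm ▸ hi) := by
    intro i hi; exact List.getD_eq_getElem _ _ _
  have hlt : ∀ i < n, l.getD i 0 < n := fun i hi => by
    rw [hget i hi]; exact h3 _ (List.getElem_mem _)
  refine ⟨?_, ?_⟩
  · intro i hi j hj hij
    have := hg.inj _ (hlt i hi) _ (hlt j hj) hij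
    rw [hget i hi, hget j hj] at this
    exact (List.Nodup.getElem_inj_iff h2).1 this
  · intro p
    obtain ⟨j, hj, hp⟩ := hg.surj p
    have hj' : j ∈ l := by
      have : l.toFinset = Finset.range n := by
        apply Finset.eq_of_subset_of_card_le
        · intro a ha; rw [List.mem_toFinset] at ha; exact Finset.mem_range.2 (h3 a ha)
        · rw [List.toFinset_card_of_nodup h2, h1, Finset.card_range]
      rw [← List.mem_toFinset, this]; exact Finset.mem_range.2 hj
    obtain ⟨i, hi, hij⟩ := List.getElem_of_mem hj'
    refine ⟨i, h1 ▸ hi, ?_⟩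
    show g (l.getD i 0) = p
    rw [hget i (h1 ▸ hi), hij, hp]

theorem Perm.ss {P : Type*} {n : ℕ} {l : List ℕ} (h : Perm n l) {g : ℕ → P}
    {L : Set (Finset P)} {d : ℕ} (hd : SS L n g d) :
    SS L n (fun i => g (l.getD i 0)) (pre l d) := by
  obtain ⟨h1, h2, h3⟩ := h
  obtain ⟨hd1, B, hB, hd2⟩ := hd
  refine ⟨h1 ▸ pre_lt l d, B, hB, fun i hi => ?_⟩
  have hi' : i < l.length := h1.symm ▸ hi
  rw [pre_testBit l d i hi']
  apply hd2
  rw [List.getD_eq_getElem _ _ hi']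
  exact h3 _ (List.getElem_mem _)

/-! ### Projective planes -/

set_option linter.unusedSectionVars false

section Planes

variable {P : Type*} [Fintype P] [DecidableEq P]

/-- Projective planes of order `q`. -/
structure Pl (q : ℕ) (L : Set (Finset P)) : Prop where
  cardP : Fintype.card P = q ^ 2 + q + 1
  card : ∀ B ∈ L, B.card = q + 1
  ex : ∀ x y : P, x ≠ y → ∃ B ∈ L, x ∈ B ∧ y ∈ B
  uniq : ∀ x y : P, x ≠ y → ∀ B ∈ L, ∀ C ∈ L, x ∈ B → y ∈ B → x ∈ C → y ∈ C → B = C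

theorem Pl.meet {q : ℕ} {L : Set (Finset P)} (h : Pl q L) (hq : 1 ≤ q) {B C : Finset P}
    (hB : B ∈ L) (hC : C ∈ L) : ∃ p, p ∈ B ∧ p ∈ C := by
  by_contra! hno
  obtain ⟨p, hp, z, hz, hpz⟩ := Finset.one_lt_card.1
    (show 1 < C.card by rw [h.card C hC]; omega)
  have hpB : p ∉ B := fun hh => hno p hh hp
  have hex : ∀ y, ∃ D, y ∈ B → D ∈ L ∧ p ∈ D ∧ y ∈ D := by
    intro y
    by_cases hy : y ∈ B
    · obtain ⟨D, hD, h1, h2⟩ := h.ex p y (by rintro rfl; exact hpB hy)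
      exact ⟨D, fun _ => ⟨hD, h1, h2⟩⟩
    · exact ⟨∅, fun hh => absurd hh hy⟩
  choose J hJ using hex
  have hdis : (B : Set P).PairwiseDisjoint (fun y => (J y).erase p) := by
    intro y hy y' hy' hne
    have hy : y ∈ B := hy
    have hy' : y' ∈ B := hy'
    show Disjoint ((J y).erase p) ((J y').erase p)
    rw [Finset.disjoint_left]
    intro w hw hw'
    rw [Finset.mem_erase] at hw hw'
    obtain ⟨a1, a2, a3⟩ := hJ y hy
    obtain ⟨b1, b2, b3⟩ := hJ y' hy'
    have e := h.uniq w p hw.1 _ a1 _ b1 hw.2 a2 hw'.2 b2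
    have e2 := h.uniq y y' hne _ a1 _ hB a3 (e ▸ b3) hy hy'
    exact hpB (e2 ▸ a2)
  have hcard := Finset.card_biUnion hdis
  have hsum : ∑ y ∈ B, ((J y).erase p).card = ∑ y ∈ B, q := by
    apply Finset.sum_congr rfl
    intro y hy
    obtain ⟨a1, a2, a3⟩ := hJ y hy
    rw [Finset.card_erase_of_mem a2, h.card _ a1]; rfl
  rw [hsum, Finset.sum_const, h.card B hB, smul_eq_mul] at hcard
  have hsub : B.biUnion (fun y => (J y).erase p) ⊆ Finset.univ.erase p := by
    intro w hw
    rw [Finset.mem_biUnion] at hw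
    obtain ⟨y, _, hw⟩ := hw
    exact Finset.mem_erase.2 ⟨(Finset.mem_erase.1 hw).1, Finset.mem_univ _⟩
  have heq := Finset.eq_of_subset_of_card_le hsub (by
    rw [hcard, Finset.card_erase_of_mem (Finset.mem_univ _), Finset.card_univ, h.cardP]
    have : (q + 1) * q = q ^ 2 + q := by ring
    omega)
  have hzm : z ∈ B.biUnion (fun y => (J y).erase p) := by
    rw [heq]; exact Finset.mem_erase.2 ⟨hpz.symm, Finset.mem_univ _⟩
  rw [Finset.mem_biUnion] at hzm
  obtain ⟨y, hy, hzy⟩ := hzm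
  obtain ⟨a1, a2, a3⟩ := hJ y hy
  have e := h.uniq p z hpz _ a1 _ hC a2 (Finset.mem_erase.1 hzy).2 hp hz
  exact hno y hy (e ▸ a3)

theorem exists_mask (n : ℕ) (g : ℕ → P) (B : Finset P) :
    ∃ c < 2 ^ n, ∀ i < n, (c.testBit i = true ↔ g i ∈ B) := by
  refine ⟨Nat.ofBits (n := n) (fun i => decide (g i ∈ B)), Nat.ofBits_lt_two_pow _, ?_⟩
  intro i hi
  rw [Nat.testBit_ofBits_lt _ _ hi]
  simp

theorem SS_of_mem {L : Set (Finset P)} (n : ℕ) (g : ℕ → P) {B : Finset P} (hB : B ∈ L) :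
    ∃ c, SS L n g c ∧ ∀ i < n, (c.testBit i = true ↔ g i ∈ B) := by
  obtain ⟨c, hc, h⟩ := exists_mask n g B
  exact ⟨c, ⟨hc, B, hB, h⟩, h⟩

theorem card_mask {n : ℕ} {g : ℕ → P} (hg : Lab n g) {B : Finset P} {c : ℕ}
    (h : ∀ i < n, (c.testBit i = true ↔ g i ∈ B)) : (bits n c).card = B.card := by
  have : (bits n c).image g = B := by
    ext p
    rw [Finset.mem_image]
    constructor
    · rintro ⟨i, hi, rfl⟩
      rw [mem_bits] at hi
      exact (h i hi.1).1 hi.2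
    · intro hp
      obtain ⟨i, hi, rfl⟩ := hg.surj p
      exact ⟨i, mem_bits.2 ⟨hi, (h i hi).2 hp⟩, rfl⟩
  rw [← this, Finset.card_image_of_injOn]
  intro i hi j hj hij
  exact hg.inj i (mem_bits.1 hi).1 j (mem_bits.1 hj).1 hij

theorem Pl.mp {q n : ℕ} {L : Set (Finset P)} (h : Pl q L) (hq : 1 ≤ q) {g : ℕ → P}
    (hg : Lab n g) : MP n q (SS L n g) := by
  refine ⟨fun c hc => hc.1, ?_, ?_, ?_⟩
  · rintro c ⟨_, B, hB, hc⟩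
    rw [card_mask hg hc, h.card B hB]
  · intro i j hi hj hij
    obtain ⟨B, hB, h1, h2⟩ := h.ex (g i) (g j) (fun e => hij (hg.inj i hi j hj e))
    obtain ⟨c, hc, hh⟩ := SS_of_mem n g hB
    exact ⟨c, hc, (hh i hi).2 h1, (hh j hj).2 h2⟩
  · rintro c d ⟨hc, B, hB, hcB⟩ ⟨hd, C, hC, hdC⟩ hne
    have hBC : B ≠ C := by
      rintro rfl
      apply hne
      apply Nat.eq_of_testBit_eq
      intro i
      rw [Bool.eq_iff_iff]
      constructor
      · intro hi
        have hin := lt_of_testBit hc hi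
        exact (hdC i hin).2 ((hcB i hin).1 hi)
      · intro hi
        have hin := lt_of_testBit hd hi
        exact (hcB i hin).2 ((hdC i hin).1 hi)
    obtain ⟨p, hpB, hpC⟩ := h.meet hq hB hC
    obtain ⟨i, hi, rfl⟩ := hg.surj p
    refine ⟨i, ?_⟩
    apply Nat.eq_of_testBit_eq
    intro j
    rw [Bool.eq_iff_iff, Nat.testBit_and, Bool.and_eq_true, Nat.testBit_two_pow,
      decide_eq_true_eq]
    constructor
    · rintro ⟨h1, h2⟩
      have hjn := lt_of_testBit hc h1
      by_contra hij
      exact hBC (h.uniq (g i) (g j) (fun e => hij (hg.inj i hi j hjn e)) B hB C hC hpB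
        ((hcB j hjn).1 h1) hpC ((hdC j hjn).1 h2))
    · rintro rfl
      exact ⟨(hcB i hi).2 hpB, (hdC i hi).2 hpC⟩

theorem Ov_of {n : ℕ} {g : ℕ → P} (hg : Lab n g) {L M : Set (Finset P)}
    (h : ∀ B ∈ L, ∀ C ∈ M, (B ∩ C).card ≤ 2) {c d : ℕ} (hc : SS L n g c) (hd : SS M n g d) :
    Ov c d := by
  obtain ⟨hc, B, hB, hcB⟩ := hc
  obtain ⟨hd, C, hC, hdC⟩ := hd
  intro i j k c1 d1 c2 d2 c3 d3 hij hik hjk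
  have h1 := lt_of_testBit hc c1
  have h2 := lt_of_testBit hc c2
  have h3 := lt_of_testBit hc c3
  have := h B hB C hC
  rw [← not_lt] at this
  apply this
  rw [Finset.two_lt_card]
  refine ⟨g i, Finset.mem_inter.2 ⟨(hcB i h1).1 c1, (hdC i h1).1 d1⟩, g j,
    Finset.mem_inter.2 ⟨(hcB j h2).1 c2, (hdC j h2).1 d2⟩, g k,
    Finset.mem_inter.2 ⟨(hcB k h3).1 c3, (hdC k h3).1 d3⟩, ?_, ?_, ?_⟩
  · exact fun e => hij (hg.inj i h1 j h2 e)
  · exact fun e => hik (hg.inj i h1 k h3 e)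
  · exact fun e => hjk (hg.inj j h2 k h3 e)

theorem Pl.SS_of {q n : ℕ} {L : Set (Finset P)} (h : Pl q L) {g : ℕ → P}
    (hg : Lab n g) {c : ℕ} (hc : c < 2 ^ n) (hcard : (bits n c).card = q + 1)
    {B : Finset P} (hB : B ∈ L) (hcB : ∀ i ∈ bits n c, g i ∈ B) : SS L n g c := by
  refine ⟨hc, B, hB, fun i hi => ⟨fun hh => hcB i (mem_bits.2 ⟨hi, hh⟩), fun hh => ?_⟩⟩
  have hinj : Set.InjOn g (bits n c : Set ℕ) := fun i hi j hj hij =>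
    hg.inj i (mem_bits.1 hi).1 j (mem_bits.1 hj).1 hij
  have : (bits n c).image g = B := by
    apply Finset.eq_of_subset_of_card_le
    · intro p hp
      obtain ⟨i, hi, rfl⟩ := Finset.mem_image.1 hp
      exact hcB i hi
    · rw [Finset.card_image_of_injOn hinj, hcard, h.card B hB]
  rw [← this] at hh
  obtain ⟨j, hj, hji⟩ := Finset.mem_image.1 hh
  have hj := mem_bits.1 hj
  have := hg.inj j hj.1 i hi hji
  exact this ▸ hj.2

theorem enum {q : ℕ} (hq : 2 ≤ q) {s : Finset P} (hs : s.card = q + 1) {a b c : P}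
    (ha : a ∈ s) (hb : b ∈ s) (hc : c ∈ s) (hab : a ≠ b) (hac : a ≠ c) (hbc : b ≠ c) :
    ∃ f : ℕ → P, f 0 = a ∧ f 1 = b ∧ f q = c ∧ (∀ i ≤ q, f i ∈ s) ∧
      ∀ i ≤ q, ∀ j ≤ q, f i = f j → i = j := by
  set r := ((s.erase a).erase b).erase c with hr
  have hrc : r.card = q - 2 := by
    rw [hr, Finset.card_erase_of_mem, Finset.card_erase_of_mem, Finset.card_erase_of_mem ha, hs]
    · omega
    · simp [hb, hab.symm]
    · simp [hc, hbc.symm, hac.symm]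
  set l := a :: b :: (r.toList ++ [c]) with hl
  have hlen : l.length = q + 1 := by
    simp [hl, hrc]; omega
  have hnd : l.Nodup := by
    have : r.toList.Nodup := r.nodup_toList
    simp only [hl, List.nodup_cons, List.nodup_append, List.mem_cons, List.mem_append,
      Finset.mem_toList]
    simp [hab, hac, hbc, this, hr]
    grind
  have hmem : ∀ x ∈ l, x ∈ s := by
    intro x hx
    simp only [hl, List.mem_cons, List.mem_append, Finset.mem_toList, List.not_mem_nil,
      or_false] at hx
    rcases hx with rfl | rfl | hx | rfl
    · exact ha
    · exact hb
    · simp [hr] at hx; exact hx.2.2.2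
    · exact hc
  have hget : ∀ i (hi : i ≤ q), l.getD i a = l[i]'(by omega) :=
    fun i hi => List.getD_eq_getElem _ _ _
  refine ⟨fun i => l.getD i a, rfl, rfl, ?_, ?_, ?_⟩
  · show l.getD q a = c
    obtain ⟨m, rfl⟩ : ∃ m, q = m + 2 := ⟨q - 2, by omega⟩
    rw [hl, List.getD_cons_succ, List.getD_cons_succ]
    have hm : r.toList.length = m := by rw [Finset.length_toList, hrc]; omega
    rw [List.getD_append_right _ _ _ _ (by omega), hm]
    simp
  · intro i hi
    show l.getD i a ∈ s
    rw [hget i hi]; exact hmem _ (List.getElem_mem _)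
  · intro i hi j hj hij
    change l.getD i a = l.getD j a at hij
    rw [hget i hi, hget j hj] at hij
    exact (List.Nodup.getElem_inj_iff hnd).1 hij

/-- The lines which are known after the introduction of coordinates. -/
def kn (q : ℕ) : List (List ℕ) :=
  ((List.range (q + 1)).map fun m => q ^ 2 + m) ::
  ((List.range q).map (fun x => q * x + x) ++ [q ^ 2 + 1]) ::
  ((List.range q).map (fun x => (List.range q).map (fun y => q * x + y) ++ [q ^ 2 + q]) ++
  (List.range q).map (fun y => (List.range q).map (fun x => q * x + y) ++ [q ^ 2]))

theorem Pl.coords {q : ℕ} (hq : 2 ≤ q) {L : Set (Finset P)} (h : Pl q L) {X Y A U : P}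
    (hXY : X ≠ Y) (hAU : A ≠ U) (hXA : X ≠ A) (hXU : X ≠ U) (hYA : Y ≠ A) (hYU : Y ≠ U)
    (h1 : ∀ B ∈ L, X ∈ B → Y ∈ B → A ∉ B) (h2 : ∀ B ∈ L, X ∈ B → Y ∈ B → U ∉ B)
    (h3 : ∀ B ∈ L, A ∈ B → U ∈ B → X ∉ B) (h4 : ∀ B ∈ L, A ∈ B → U ∈ B → Y ∉ B) :
    ∃ g : ℕ → P, Lab (q ^ 2 + q + 1) g ∧ g 0 = A ∧ g (q + 1) = U ∧ g (q ^ 2) = X ∧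
      g (q ^ 2 + q) = Y ∧ ∀ ks ∈ kn q, ∃ B ∈ L, ∀ k ∈ ks, g k ∈ B := by
  obtain ⟨W, hW, hXW, hYW⟩ := h.ex X Y hXY
  obtain ⟨D, hD, hAD, hUD⟩ := h.ex A U hAU
  obtain ⟨I, hIW, hID⟩ := h.meet (by omega) hW hD
  have hWD : W ≠ D := by rintro rfl; exact h1 W hW hXW hYW hAD
  have hIA : A ≠ I := by rintro rfl; exact h1 W hW hXW hYW hIW
  have hIU : U ≠ I := by rintro rfl; exact h2 W hW hXW hYW hIW
  have hIX : X ≠ I := by rintro rfl; exact h3 D hD hAD hUD hID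
  have hIY : I ≠ Y := by rintro rfl; exact h4 D hD hAD hUD hID
  obtain ⟨d, d0, d1, dq, dD, dinj⟩ := enum hq (h.card D hD) hAD hUD hID hAU hIA hIU
  obtain ⟨e, e0, e1, eq, eW, einj⟩ := enum hq (h.card W hW) hXW hIW hYW hIX hXY hIY
  have hdW : ∀ x < q, d x ∉ W := by
    intro x hx hxW
    by_cases hxI : d x = I
    · have := dinj x hx.le q le_rfl (hxI.trans dq.symm); omega
    · exact hWD (h.uniq _ _ hxI W hW D hD hxW hIW (dD x hx.le) hID)
  have hV : ∀ x, ∃ V, x < q → V ∈ L ∧ Y ∈ V ∧ d x ∈ V := by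
    intro x
    by_cases hx : x < q
    · obtain ⟨V, a, b, c⟩ := h.ex Y (d x) (by intro hh; exact hdW x hx (hh ▸ hYW))
      exact ⟨V, fun _ => ⟨a, b, c⟩⟩
    · exact ⟨∅, fun hh => absurd hh hx⟩
  have hH : ∀ x, ∃ V, x < q → V ∈ L ∧ X ∈ V ∧ d x ∈ V := by
    intro x
    by_cases hx : x < q
    · obtain ⟨V, a, b, c⟩ := h.ex X (d x) (by intro hh; exact hdW x hx (hh ▸ hXW))
      exact ⟨V, fun _ => ⟨a, b, c⟩⟩
    · exact ⟨∅, fun hh => absurd hh hx⟩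
  choose V hV using hV
  choose H hH using hH
  have hVH : ∀ x < q, ∀ y < q, V x ≠ H y := by
    intro x hx y hy hh
    obtain ⟨a1, a2, a3⟩ := hV x hx
    obtain ⟨b1, b2, b3⟩ := hH y hy
    have := h.uniq X Y hXY _ a1 W hW (hh ▸ b2) a2 hXW hYW
    exact hdW x hx (this ▸ a3)
  have hpt : ∀ x y, ∃ p, x < q → y < q → p ∈ V x ∧ p ∈ H y := by
    intro x y
    by_cases hx : x < q
    · by_cases hy : y < q
      · obtain ⟨p, hp⟩ := h.meet (by omega) (hV x hx).1 (hH y hy).1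
        exact ⟨p, fun _ _ => hp⟩
      · exact ⟨X, fun _ hh => absurd hh hy⟩
    · exact ⟨X, fun hh => absurd hh hx⟩
  choose pt hpt using hpt
  have hptW : ∀ x < q, ∀ y < q, pt x y ∉ W := by
    intro x hx y hy hp
    obtain ⟨a1, a2, a3⟩ := hV x hx
    obtain ⟨b1, b2, b3⟩ := hH y hy
    obtain ⟨c1, c2⟩ := hpt x y hx hy
    have hpY : pt x y = Y := by
      by_contra hne
      have := h.uniq _ _ hne _ a1 W hW c1 a2 hp hYW
      exact hdW x hx (this ▸ a3)
    have hpX : pt x y = X := by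
      by_contra hne
      have := h.uniq _ _ hne _ b1 W hW c2 b2 hp hXW
      exact hdW y hy (this ▸ b3)
    exact hXY (hpX.symm.trans hpY)
  have hYD : Y ∉ D := h4 D hD hAD hUD
  have hXD : X ∉ D := h3 D hD hAD hUD
  have hptinj : ∀ x < q, ∀ y < q, ∀ x' < q, ∀ y' < q, pt x y = pt x' y' → x = x' ∧ y = y' := by
    intro x hx y hy x' hx' y' hy' hp
    obtain ⟨a1, a2, a3⟩ := hV x hx
    obtain ⟨b1, b2, b3⟩ := hH y hy
    obtain ⟨a1', a2', a3'⟩ := hV x' hx'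
    obtain ⟨b1', b2', b3'⟩ := hH y' hy'
    obtain ⟨c1, c2⟩ := hpt x y hx hy
    obtain ⟨c1', c2'⟩ := hpt x' y' hx' hy'
    have hnW := hptW x hx y hy
    constructor
    · have hVV : V x = V x' := h.uniq (pt x y) Y (by intro hh; exact hnW (hh ▸ hYW)) _ a1 _ a1'
        c1 a2 (hp ▸ c1') a2'
      by_contra hne
      have := h.uniq (d x) (d x') (fun hh => hne (dinj x hx.le x' hx'.le hh)) _ a1 D hD a3
        (hVV ▸ a3') (dD x hx.le) (dD x' hx'.le)
      exact hYD (this ▸ a2)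
    · have hVV : H y = H y' := h.uniq (pt x y) X (by intro hh; exact hnW (hh ▸ hXW)) _ b1 _ b1'
        c2 b2 (hp ▸ c2') b2'
      by_contra hne
      have := h.uniq (d y) (d y') (fun hh => hne (dinj y hy.le y' hy'.le hh)) _ b1 D hD b3
        (hVV ▸ b3') (dD y hy.le) (dD y' hy'.le)
      exact hXD (this ▸ b2)
  have hdiag : ∀ x < q, pt x x = d x := by
    intro x hx
    obtain ⟨a1, a2, a3⟩ := hV x hx
    obtain ⟨b1, b2, b3⟩ := hH x hx
    obtain ⟨c1, c2⟩ := hpt x x hx hx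
    by_contra hne
    exact hVH x hx x hx (h.uniq _ _ hne _ a1 _ b1 c1 a3 c2 b3)
  set g : ℕ → P := fun k => if k < q ^ 2 then pt (k / q) (k % q) else e (k - q ^ 2) with hg
  have hg1 : ∀ x < q, ∀ y < q, g (q * x + y) = pt x y := by
    intro x hx y hy
    have hlt : q * x + y < q ^ 2 := by nlinarith
    have e1 : (q * x + y) / q = x := by
      rw [Nat.mul_add_div (by omega), Nat.div_eq_of_lt hy, add_zero]
    have e2 : (q * x + y) % q = y := by
      rw [Nat.mul_add_mod, Nat.mod_eq_of_lt hy]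
    simp only [hg, if_pos hlt, e1, e2]
  have hg2 : ∀ m, g (q ^ 2 + m) = e m := by
    intro m
    simp [hg]
  have hsplit : ∀ k < q ^ 2 + q + 1, (∃ x < q, ∃ y < q, k = q * x + y) ∨
      ∃ m ≤ q, k = q ^ 2 + m := by
    intro k hk
    by_cases hk2 : k < q ^ 2
    · left
      refine ⟨k / q, ?_, k % q, Nat.mod_lt _ (by omega), (Nat.div_add_mod k q).symm⟩
      rw [Nat.div_lt_iff_lt_mul (by omega)]; nlinarith
    · right; exact ⟨k - q ^ 2, by omega, by omega⟩
  have ginj : ∀ i < q ^ 2 + q + 1, ∀ j < q ^ 2 + q + 1, g i = g j → i = j := by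
    intro i hi j hj hij
    rcases hsplit i hi with ⟨x, hx, y, hy, rfl⟩ | ⟨m, hm, rfl⟩ <;>
      rcases hsplit j hj with ⟨x', hx', y', hy', rfl⟩ | ⟨m', hm', rfl⟩
    · rw [hg1 x hx y hy, hg1 x' hx' y' hy'] at hij
      obtain ⟨rfl, rfl⟩ := hptinj x hx y hy x' hx' y' hy' hij
      rfl
    · rw [hg1 x hx y hy, hg2] at hij
      exact absurd (hij ▸ eW m' hm') (hptW x hx y hy)
    · rw [hg1 x' hx' y' hy', hg2] at hij
      exact absurd (hij ▸ eW m hm) (hptW x' hx' y' hy')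
    · rw [hg2, hg2] at hij
      rw [einj m hm m' hm' hij]
  refine ⟨g, ⟨ginj, ?_⟩, ?_, ?_, ?_, ?_, ?_⟩
  · have : (Finset.range (q ^ 2 + q + 1)).image g = Finset.univ := by
      apply Finset.eq_univ_of_card
      rw [Finset.card_image_of_injOn, Finset.card_range, h.cardP]
      intro i hi j hj hij
      exact ginj i (by simpa using hi) j (by simpa using hj) hij
    intro p
    have hp : p ∈ (Finset.range (q ^ 2 + q + 1)).image g := by rw [this]; exact Finset.mem_univ p
    obtain ⟨i, hi, hip⟩ := Finset.mem_image.1 hp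
    exact ⟨i, Finset.mem_range.1 hi, hip⟩
  · have := hg1 0 (by omega) 0 (by omega)
    rw [mul_zero, add_zero] at this
    rw [this, hdiag 0 (by omega), d0]
  · have := hg1 1 (by omega) 1 (by omega)
    rw [mul_one] at this
    rw [this, hdiag 1 (by omega), d1]
  · have := hg2 0
    rw [add_zero] at this
    rw [this, e0]
  · rw [hg2, eq]
  · intro ks hks
    simp only [kn, List.mem_cons, List.mem_append, List.mem_map, List.mem_range] at hks
    rcases hks with rfl | rfl | ⟨x, hx, rfl⟩ | ⟨y, hy, rfl⟩
    · refine ⟨W, hW, fun k hk => ?_⟩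
      simp only [List.mem_map, List.mem_range] at hk
      obtain ⟨m, hm, rfl⟩ := hk
      rw [hg2]; exact eW m (by omega)
    · refine ⟨D, hD, fun k hk => ?_⟩
      simp only [List.mem_append, List.mem_map, List.mem_range, List.mem_singleton] at hk
      rcases hk with ⟨x, hx, rfl⟩ | rfl
      · rw [hg1 x hx x hx, hdiag x hx]; exact dD x hx.le
      · rw [hg2, e1]; exact hID
    · refine ⟨V x, (hV x hx).1, fun k hk => ?_⟩
      simp only [List.mem_append, List.mem_map, List.mem_range, List.mem_singleton] at hk
      rcases hk with ⟨y, hy, rfl⟩ | rfl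
      · rw [hg1 x hx y hy]; exact (hpt x y hx hy).1
      · rw [hg2, eq]; exact (hV x hx).2.1
    · refine ⟨H y, (hH y hy).1, fun k hk => ?_⟩
      simp only [List.mem_append, List.mem_map, List.mem_range, List.mem_singleton] at hk
      rcases hk with ⟨x, hx, rfl⟩ | rfl
      · rw [hg1 x hx y hy]; exact (hpt x y hx hy).2
      · have := hg2 0
        rw [add_zero] at this
        rw [this, e0]; exact (hH y hy).2.1

end Planes

/-! ### The main argument for `q = 4, 5` -/

theorem master {P : Type*} [Fintype P] [DecidableEq P] {q n need2 need3 frame m0 i₁ i₂ : ℕ}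
    {std known js1 slopes js3 centers : List ℕ} {imgs1 : List (List ℕ × List ℕ)}
    {imgs2 : List (List ℕ × ℕ)}
    (hn : n = q ^ 2 + q + 1) (hq2 : q = need2 + 3) (hq3 : q = need3 + 1)
    (hjs1 : JS n js1) (hjs3 : JS n js3)
    (hsl : ∀ P ∈ slopes, ∃ p < n, P = 2 ^ p) (hce : ∀ P ∈ centers, ∃ p < n, P = 2 ^ p)
    (hkn : ∀ c ∈ known, c < 2 ^ n ∧ (bits n c).card = q + 1 ∧
      ∃ ks ∈ kn q, ∀ i ∈ bits n c, i ∈ ks)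
    (him1 : ∀ e ∈ imgs1, Perm n e.1 ∧ e.1.getD 0 0 = 0 ∧ e.1.getD (q + 1) 0 = q + 1 ∧
      e.1.getD (q ^ 2) 0 = q ^ 2 ∧ e.1.getD (q ^ 2 + q) 0 = q ^ 2 + q ∧ e.2.map (pre e.1) = std)
    (hf : frame < 2 ^ n) (hfb : bits n frame = {0, q + 1, q ^ 2, q ^ 2 + q})
    (him2 : ∀ e ∈ imgs2, Perm n e.1 ∧ pre e.1 e.2 = m0 ∧ ∀ s ∈ std, s ∈ std.map (pre e.1))
    (hi₁ : m0.testBit i₁ = true) (hi₂ : m0.testBit i₂ = true) (hi : i₁ ≠ i₂)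
    (c1 : check1 q (2 ^ n - 1) known js1 slopes imgs1 = true)
    (c2 : check2 need2 (2 ^ n - 1) frame std js1 imgs2 = true)
    (c3 : check3 q need3 (2 ^ n - 1) m0 (2 ^ i₁ ||| 2 ^ i₂) std js3 centers = true)
    {L₁ L₂ L₃ : Set (Finset P)} (h₁ : Pl q L₁) (h₂ : Pl q L₂) (h₃ : Pl q L₃)
    (h12 : ∀ B ∈ L₁, ∀ C ∈ L₂, (B ∩ C).card ≤ 2)
    (h13 : ∀ B ∈ L₁, ∀ C ∈ L₃, (B ∩ C).card ≤ 2)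
    (h23 : ∀ B ∈ L₂, ∀ C ∈ L₃, (B ∩ C).card ≤ 2) : False := by
  subst hn
  set n := q ^ 2 + q + 1 with hn
  have hq : 3 ≤ q := by omega
  have hqq : q ^ 2 = q * q := sq q
  -- a block of the second plane and four of its points
  obtain ⟨x, y, hxy⟩ : ∃ x y : P, x ≠ y := by
    have : 1 < Fintype.card P := by rw [h₂.cardP]; nlinarith
    exact Fintype.exists_pair_of_one_lt_card this
  obtain ⟨m, hm, -, -⟩ := h₂.ex x y hxy
  obtain ⟨a, b, c, ha, hb, hc, hab, hac, hbc⟩ := Finset.two_lt_card_iff.1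
    (show 2 < m.card by rw [h₂.card m hm]; omega)
  obtain ⟨f, -, -, -, hfm, finj⟩ := enum (by omega) (h₂.card m hm) ha hb hc hab hac hbc
  have hne : ∀ i j, i ≤ 3 → j ≤ 3 → i ≠ j → f i ≠ f j := by
    intro i j hi hj hij e
    exact hij (finj i (by omega) j (by omega) e)
  have hcol : ∀ i j k, i ≤ 3 → j ≤ 3 → k ≤ 3 → i ≠ j → i ≠ k → j ≠ k →
      ∀ B ∈ L₁, f i ∈ B → f j ∈ B → f k ∉ B := by
    intro i j k hi hj hk hij hik hjk B hB h1 h2 h3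
    have := h12 B hB m hm
    rw [← not_lt] at this
    apply this
    rw [Finset.two_lt_card]
    exact ⟨f i, Finset.mem_inter.2 ⟨h1, hfm i (by omega)⟩, f j,
      Finset.mem_inter.2 ⟨h2, hfm j (by omega)⟩, f k,
      Finset.mem_inter.2 ⟨h3, hfm k (by omega)⟩, hne i j hi hj hij, hne i k hi hk hik,
      hne j k hj hk hjk⟩
  obtain ⟨g, hg, g0, g1, g2, g3, hgk⟩ := h₁.coords (by omega) (X := f 0) (Y := f 1) (A := f 2)
    (U := f 3)
    (hne 0 1 (by omega) (by omega) (by omega)) (hne 2 3 (by omega) (by omega) (by omega))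
    (hne 0 2 (by omega) (by omega) (by omega)) (hne 0 3 (by omega) (by omega) (by omega))
    (hne 1 2 (by omega) (by omega) (by omega)) (hne 1 3 (by omega) (by omega) (by omega))
    (hcol 0 1 2 (by omega) (by omega) (by omega) (by omega) (by omega) (by omega))
    (hcol 0 1 3 (by omega) (by omega) (by omega) (by omega) (by omega) (by omega))
    (hcol 2 3 0 (by omega) (by omega) (by omega) (by omega) (by omega) (by omega))
    (hcol 2 3 1 (by omega) (by omega) (by omega) (by omega) (by omega) (by omega))
  -- first phase
  obtain ⟨e, he, hes⟩ := check1_sound (h₁.mp (by omega) hg) hjs1 hsl (by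
    intro c hc
    obtain ⟨k1, k2, ks, hks, k3⟩ := hkn c hc
    obtain ⟨B, hB, hB'⟩ := hgk ks hks
    exact h₁.SS_of hg k1 k2 hB (fun i hi => hB' i (k3 i hi))) c1
  obtain ⟨p1, p2, p3, p4, p5, p6⟩ := him1 e he
  have hg' := p1.lab hg
  have hstd : ∀ s ∈ std, SS L₁ n (fun i => g (e.1.getD i 0)) s := by
    intro s hs
    rw [← p6, List.mem_map] at hs
    obtain ⟨d, hd, rfl⟩ := hs
    exact p1.ss (hes d hd)
  have hgm : ∀ i ∈ bits n frame, (fun i => g (e.1.getD i 0)) i ∈ m := by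
    intro i hi
    show g (e.1.getD i 0) ∈ m
    rw [hfb] at hi
    simp only [Finset.mem_insert, Finset.mem_singleton] at hi
    rcases hi with rfl | rfl | rfl | rfl
    · rw [p2, g0]; exact hfm 2 (by omega)
    · rw [p3, g1]; exact hfm 3 (by omega)
    · rw [p4, g2]; exact hfm 0 (by omega)
    · rw [p5, g3]; exact hfm 1 (by omega)
  generalize (fun i => g (e.1.getD i 0)) = g' at hg' hstd hgm
  -- second phase
  obtain ⟨c, hc, hcm⟩ := SS_of_mem n g' hm
  have hmp2 := h₂.mp (by omega) hg'
  have hfc : (bits n frame).card = 4 := by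
    rw [hfb]
    have a1 : q + 1 < q ^ 2 := by nlinarith
    rw [Finset.card_insert_of_notMem, Finset.card_insert_of_notMem, Finset.card_insert_of_notMem,
      Finset.card_singleton]
    · simp; omega
    · simp; omega
    · simp; omega
  obtain ⟨e', he', hec⟩ := check2_sound hjs1 hf hc.1
    (fun s hs => Ov_of hg' h12 (hstd s hs) hc) (by
      intro i hi
      have hin := lt_of_testBit hf hi
      exact (hcm i hin).2 (hgm i (mem_bits.2 ⟨hin, hi⟩)))
    (by rw [hmp2.card c hc, hfc]; omega) c2
  obtain ⟨r1, r2, r3⟩ := him2 e' he'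
  have hg'' := r1.lab hg'
  have hm0 := r1.ss hc
  rw [← hec, r2] at hm0
  have hstd' : ∀ s ∈ std, SS L₁ n (fun i => g' (e'.1.getD i 0)) s := by
    intro s hs
    obtain ⟨d, hd, rfl⟩ := List.mem_map.1 (r3 s hs)
    exact r1.ss (hstd d hd)
  generalize (fun i => g' (e'.1.getD i 0)) = G at hg'' hstd' hm0
  -- third phase
  have hS2 := h₂.mp (by omega) hg''
  have hS3 := h₃.mp (by omega) hg''
  have l1 := lt_of_testBit hm0.1 hi₁
  have l2 := lt_of_testBit hm0.1 hi₂
  obtain ⟨t, ht, t1, t2⟩ := hS3.ex i₁ i₂ l1 l2 hi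
  have hw : ∀ i, (2 ^ i₁ ||| 2 ^ i₂).testBit i = true ↔ i = i₁ ∨ i = i₂ := by
    intro i
    rw [Nat.testBit_or, Nat.testBit_two_pow, Nat.testBit_two_pow]
    simp only [Bool.or_eq_true, decide_eq_true_eq]
    exact or_congr eq_comm eq_comm
  have hwc : (bits n (2 ^ i₁ ||| 2 ^ i₂)).card = 2 := by
    have : bits n (2 ^ i₁ ||| 2 ^ i₂) = {i₁, i₂} := by
      ext i
      rw [mem_bits, hw]
      simp only [Finset.mem_insert, Finset.mem_singleton]
      constructor
      · exact fun h => h.2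
      · rintro (rfl | rfl)
        · exact ⟨l1, Or.inl rfl⟩
        · exact ⟨l2, Or.inr rfl⟩
    rw [this, Finset.card_pair hi]
  refine check3_sound hS2 hjs3 hce hm0 (fun s hs c hc => Ov_of hg'' h12 (hstd' s hs) hc) ?_
    ((hw i₁).2 (Or.inl rfl)) ((hw i₂).2 (Or.inr rfl)) hi ht.1
    (fun s hs => Ov_of hg'' h13 (hstd' s hs) ht) (fun c hc => Ov_of hg'' h23 hc ht) ?_ ?_ c3
  · intro i h
    rcases (hw i).1 h with rfl | rfl <;> assumption
  · intro i h
    rcases (hw i).1 h with rfl | rfl <;> assumption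
  · rw [hS3.card t ht, hwc]; omega

/-! ### Order four -/

set_option maxRecDepth 100000

/-- The lines of the standard plane of order 4. -/
def std4 : List ℕ :=
  [272449, 267394, 295444, 278824, 541313, 557378, 530468, 533528, 69905, 74274, 83012, 100488,
   164897, 149522, 139652, 135752, 1048591, 1048816, 1052416, 1110016, 2031616]

/-- The lines known from the choice of coordinates. -/
def known4 : List ℕ :=
  [2031616, 164897, 1048591, 1048816, 1052416, 1110016, 69905, 74274, 83012, 100488]

/-- All points. -/
def jsA4 : List ℕ :=
  [1, 2, 4, 8, 16, 32, 64, 128, 256, 512, 1024, 2048, 4096, 8192, 16384, 32768, 65536, 131072,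
   262144, 524288, 1048576]

/-- All points, in a good order. -/
def jsB4 : List ℕ :=
  [4, 16384, 32768, 8192, 2, 131072, 524288, 128, 32, 512, 256, 262144, 64, 1, 8, 16, 2048,
   1024, 1048576, 65536, 4096]

/-- Points at infinity. -/
def slopes4 : List ℕ :=
  [131072, 262144, 524288]

/-- The points of the chosen oval. -/
def centers4 : List ℕ :=
  [1048576, 1, 32, 2048, 65536]

/-- Planes extending the known lines. -/
def imgsA4 : List (List ℕ × List ℕ) :=
  [([0, 1, 2, 3, 4, 5, 6, 7, 8, 9, 10, 11, 12, 13, 14, 15, 16, 17, 18, 19, 20], [272449, 267394,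
   295444, 278824, 541313, 557378, 530468, 533528, 69905, 74274, 83012, 100488, 164897, 149522,
   139652, 135752, 1048591, 1048816, 1052416, 1110016, 2031616]), ([0, 1, 2, 3, 4, 5, 6, 7, 8,
   9, 10, 11, 12, 13, 14, 15, 16, 17, 19, 18, 20], [534593, 529538, 557588, 540968, 279169,
   295234, 268324, 271384, 69905, 74274, 83012, 100488, 164897, 149522, 139652, 135752, 1048591,
   1048816, 1052416, 1110016, 2031616])]

/-- Ovals through the frame. -/
def imgsB4 : List (List ℕ × ℕ) :=
  [([0, 1, 2, 3, 4, 5, 6, 7, 8, 9, 10, 11, 12, 13, 14, 15, 16, 17, 18, 19, 20], 1116193), ([0,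
   1, 3, 2, 4, 5, 7, 6, 12, 13, 15, 14, 8, 9, 11, 10, 16, 17, 19, 18, 20], 1130529)]

theorem cA4 : check1 4 (2 ^ 21 - 1) known4 jsA4 slopes4 imgsA4 = true := by
  decide +kernel

theorem cB4 : check2 1 (2 ^ 21 - 1) 1114145 std4 jsA4 imgsB4 = true := by
  decide +kernel

theorem cC4 : check3 4 3 (2 ^ 21 - 1) 1116193 (2 ^ 16 ||| 2 ^ 11) std4 jsB4 centers4 =
    true := by
  decide +kernel

theorem final4 {P : Type*} [Fintype P] [DecidableEq P]
    {L₁ L₂ L₃ : Set (Finset P)} (h₁ : Pl 4 L₁) (h₂ : Pl 4 L₂) (h₃ : Pl 4 L₃)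
    (h12 : ∀ B ∈ L₁, ∀ C ∈ L₂, (B ∩ C).card ≤ 2)
    (h13 : ∀ B ∈ L₁, ∀ C ∈ L₃, (B ∩ C).card ≤ 2)
    (h23 : ∀ B ∈ L₂, ∀ C ∈ L₃, (B ∩ C).card ≤ 2) : False := by
  refine master (q := 4) (n := 21) (need2 := 1) (need3 := 3) (frame := 1114145)
    (m0 := 1116193) (i₁ := 16) (i₂ := 11) (std := std4) (known := known4) (js1 := jsA4)
    (slopes := slopes4) (js3 := jsB4) (centers := centers4) (imgs1 := imgsA4)
    (imgs2 := imgsB4) (by norm_num) (by norm_num) (by norm_num) ?_ ?_ ?_ ?_ ?_ ?_ ?_ ?_ ?_ ?_ ?_ ?_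
    cA4 cB4 cC4 h₁ h₂ h₃ h12 h13 h23
  · unfold JS; decide +kernel
  · unfold JS; decide +kernel
  · decide +kernel
  · decide +kernel
  · decide +kernel
  · unfold Perm; decide +kernel
  · norm_num
  · decide +kernel
  · unfold Perm; decide +kernel
  · decide +kernel
  · decide +kernel
  · norm_num

/-! ### Order five -/

/-- The lines of the standard plane of order 5. -/
def std5 : List ℕ :=
  [142688385, 151127298, 135531012, 136843304, 138453072, 273156353, 276861442, 285286436,
   269631560, 270795920, 539107841, 541343778, 545784900, 553683080, 537989392, 34636833,
   35719234, 37884036, 42213640, 50872848, 84152385, 68690050, 69255428, 71370248, 75630640,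
   1073741855, 1073742816, 1073773568, 1074757632, 1106247680, 2113929216]

/-- The lines known from the choice of coordinates. -/
def known5 : List ℕ :=
  [2113929216, 84152385, 1073741855, 1073742816, 1073773568, 1074757632, 1106247680, 34636833,
   35719234, 37884036, 42213640, 50872848]

/-- All points. -/
def jsA5 : List ℕ :=
  [1, 2, 4, 8, 16, 32, 64, 128, 256, 512, 1024, 2048, 4096, 8192, 16384, 32768, 65536, 131072,
   262144, 524288, 1048576, 2097152, 4194304, 8388608, 16777216, 33554432, 67108864, 134217728,
   268435456, 536870912, 1073741824]

/-- All points, in a good order. -/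
def jsB5 : List ℕ :=
  [16, 134217728, 1048576, 33554432, 8, 4194304, 512, 8192, 67108864, 1024, 268435456, 2097152,
   65536, 64, 8388608, 131072, 2, 262144, 524288, 32, 2048, 128, 32768, 16384, 536870912, 4096,
   16777216, 1, 4, 256, 1073741824]

/-- Points at infinity. -/
def slopes5 : List ℕ :=
  [67108864, 134217728, 268435456, 536870912]

/-- The points of the chosen oval. -/
def centers5 : List ℕ :=
  [131072, 1, 1073741824, 8388608, 33554432, 64]

/-- Planes extending the known lines. -/
def imgsA5 : List (List ℕ × List ℕ) :=
  [([0, 1, 2, 3, 4, 5, 6, 7, 8, 9, 10, 11, 12, 13, 14, 15, 16, 17, 18, 19, 20, 21, 22, 23, 24,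
   25, 26, 27, 28, 29, 30], [142688385, 151127298, 135531012, 136843304, 138453072, 273156353,
   276861442, 285286436, 269631560, 270795920, 539107841, 541343778, 545784900, 553683080,
   537989392, 34636833, 35719234, 37884036, 42213640, 50872848, 84152385, 68690050, 69255428,
   71370248, 75630640, 1073741855, 1073742816, 1073773568, 1074757632, 1106247680, 2113929216]),
   ([0, 1, 2, 3, 4, 5, 6, 7, 8, 9, 10, 11, 12, 13, 14, 15, 16, 17, 18, 19, 20, 21, 22, 23, 24,
   25, 26, 27, 29, 28, 30], [142688385, 151127298, 135531012, 136843304, 138453072, 541591809,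
   545296898, 553721892, 538067016, 539231376, 270672385, 272908322, 277349444, 285247624,
   269553936, 34636833, 35719234, 37884036, 42213640, 50872848, 84152385, 68690050, 69255428,
   71370248, 75630640, 1073741855, 1073742816, 1073773568, 1074757632, 1106247680, 2113929216]),
   ([0, 1, 2, 3, 4, 5, 6, 7, 8, 9, 10, 11, 12, 13, 14, 15, 16, 17, 18, 19, 20, 21, 22, 23, 24,
   25, 26, 28, 27, 29, 30], [276906113, 285345026, 269748740, 271061032, 272670800, 138938625,
   142643714, 151068708, 135413832, 136578192, 539107841, 541343778, 545784900, 553683080,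
   537989392, 34636833, 35719234, 37884036, 42213640, 50872848, 84152385, 68690050, 69255428,
   71370248, 75630640, 1073741855, 1073742816, 1073773568, 1074757632, 1106247680, 2113929216]),
   ([0, 1, 2, 3, 4, 5, 6, 7, 8, 9, 10, 11, 12, 13, 14, 15, 16, 17, 18, 19, 20, 21, 22, 23, 24,
   25, 26, 28, 29, 27, 30], [276906113, 285345026, 269748740, 271061032, 272670800, 541591809,
   545296898, 553721892, 538067016, 539231376, 136454657, 138690594, 143131716, 151029896,
   135336208, 34636833, 35719234, 37884036, 42213640, 50872848, 84152385, 68690050, 69255428,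
   71370248, 75630640, 1073741855, 1073742816, 1073773568, 1074757632, 1106247680, 2113929216]),
   ([0, 1, 2, 3, 4, 5, 6, 7, 8, 9, 10, 11, 12, 13, 14, 15, 16, 17, 18, 19, 20, 21, 22, 23, 24,
   25, 26, 29, 27, 28, 30], [545341569, 553780482, 538184196, 539496488, 541106256, 138938625,
   142643714, 151068708, 135413832, 136578192, 270672385, 272908322, 277349444, 285247624,
   269553936, 34636833, 35719234, 37884036, 42213640, 50872848, 84152385, 68690050, 69255428,
   71370248, 75630640, 1073741855, 1073742816, 1073773568, 1074757632, 1106247680, 2113929216]),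
   ([0, 1, 2, 3, 4, 5, 6, 7, 8, 9, 10, 11, 12, 13, 14, 15, 16, 17, 18, 19, 20, 21, 22, 23, 24,
   25, 26, 29, 28, 27, 30], [545341569, 553780482, 538184196, 539496488, 541106256, 273156353,
   276861442, 285286436, 269631560, 270795920, 136454657, 138690594, 143131716, 151029896,
   135336208, 34636833, 35719234, 37884036, 42213640, 50872848, 84152385, 68690050, 69255428,
   71370248, 75630640, 1073741855, 1073742816, 1073773568, 1074757632, 1106247680, 2113929216]),
   ([0, 1, 2, 4, 3, 5, 6, 7, 9, 8, 10, 11, 12, 14, 13, 20, 21, 22, 24, 23, 15, 16, 17, 19, 18,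
   25, 26, 27, 28, 29, 30], [136847489, 138675714, 151030020, 142676016, 135413832, 276957697,
   270012674, 270811172, 272670800, 285279368, 541147393, 553787426, 545784900, 538183824,
   539005448, 34636833, 35719234, 37884036, 50872848, 42213640, 84152385, 75546754, 68231684,
   69338384, 71829544, 1073741855, 1073742816, 1073773568, 1106247680, 1074757632, 2113929216]),
   ([0, 1, 2, 4, 3, 5, 6, 7, 9, 8, 10, 11, 12, 14, 13, 20, 21, 22, 24, 23, 15, 16, 17, 19, 18,
   25, 26, 27, 29, 28, 30], [136847489, 138675714, 151030020, 142676016, 135413832, 545393153,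
   538448130, 539246628, 541106256, 553714824, 272711937, 285351970, 277349444, 269748368,
   270569992, 34636833, 35719234, 37884036, 50872848, 42213640, 84152385, 75546754, 68231684,
   69338384, 71829544, 1073741855, 1073742816, 1073773568, 1106247680, 1074757632, 2113929216]),
   ([0, 1, 2, 4, 3, 5, 6, 7, 9, 8, 10, 11, 12, 14, 13, 20, 21, 22, 24, 23, 15, 16, 17, 19, 18,
   25, 26, 28, 27, 29, 30], [271065217, 272893442, 285247748, 276893744, 269631560, 142739969,
   135794946, 136593444, 138453072, 151061640, 541147393, 553787426, 545784900, 538183824,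
   539005448, 34636833, 35719234, 37884036, 50872848, 42213640, 84152385, 75546754, 68231684,
   69338384, 71829544, 1073741855, 1073742816, 1073773568, 1106247680, 1074757632, 2113929216]),
   ([0, 1, 2, 4, 3, 5, 6, 7, 9, 8, 10, 11, 12, 14, 13, 20, 21, 22, 24, 23, 15, 16, 17, 19, 18,
   25, 26, 28, 29, 27, 30], [271065217, 272893442, 285247748, 276893744, 269631560, 545393153,
   538448130, 539246628, 541106256, 553714824, 138494209, 151134242, 143131716, 135530640,
   136352264, 34636833, 35719234, 37884036, 50872848, 42213640, 84152385, 75546754, 68231684,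
   69338384, 71829544, 1073741855, 1073742816, 1073773568, 1106247680, 1074757632, 2113929216]),
   ([0, 1, 2, 4, 3, 5, 6, 7, 9, 8, 10, 11, 12, 14, 13, 20, 21, 22, 24, 23, 15, 16, 17, 19, 18,
   25, 26, 29, 27, 28, 30], [539500673, 541328898, 553683204, 545329200, 538067016, 142739969,
   135794946, 136593444, 138453072, 151061640, 272711937, 285351970, 277349444, 269748368,
   270569992, 34636833, 35719234, 37884036, 50872848, 42213640, 84152385, 75546754, 68231684,
   69338384, 71829544, 1073741855, 1073742816, 1073773568, 1106247680, 1074757632, 2113929216]),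
   ([0, 1, 2, 4, 3, 5, 6, 7, 9, 8, 10, 11, 12, 14, 13, 20, 21, 22, 24, 23, 15, 16, 17, 19, 18,
   25, 26, 29, 28, 27, 30], [539500673, 541328898, 553683204, 545329200, 538067016, 276957697,
   270012674, 270811172, 272670800, 285279368, 138494209, 151134242, 143131716, 135530640,
   136352264, 34636833, 35719234, 37884036, 50872848, 42213640, 84152385, 75546754, 68231684,
   69338384, 71829544, 1073741855, 1073742816, 1073773568, 1106247680, 1074757632, 2113929216]),
   ([0, 1, 3, 2, 4, 5, 6, 8, 7, 9, 15, 16, 18, 17, 19, 10, 11, 13, 12, 14, 20, 21, 23, 22, 24,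
   25, 26, 27, 28, 29, 30], [138938625, 151036034, 135336456, 136593444, 142738512, 276906113,
   272893442, 285345832, 270016580, 270569744, 539107841, 545787938, 541114440, 553714948,
   538183824, 34636833, 35719234, 42213640, 37884036, 50872848, 84152385, 68305154, 69731464,
   75532804, 71376944, 1073741855, 1073742816, 1074757632, 1073773568, 1106247680, 2113929216]),
   ([0, 1, 3, 2, 4, 5, 6, 8, 7, 9, 15, 16, 18, 17, 19, 10, 11, 13, 12, 14, 20, 21, 23, 22, 24,
   25, 26, 27, 29, 28, 30], [138938625, 151036034, 135336456, 136593444, 142738512, 545341569,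
   541328898, 553781288, 538452036, 539005200, 270672385, 277352482, 272678984, 285279492,
   269748368, 34636833, 35719234, 42213640, 37884036, 50872848, 84152385, 68305154, 69731464,
   75532804, 71376944, 1073741855, 1073742816, 1074757632, 1073773568, 1106247680, 2113929216]),
   ([0, 1, 3, 2, 4, 5, 6, 8, 7, 9, 15, 16, 18, 17, 19, 10, 11, 13, 12, 14, 20, 21, 23, 22, 24,
   25, 26, 28, 27, 29, 30], [273156353, 285253762, 269554184, 270811172, 276956240, 142688385,
   138675714, 151128104, 135798852, 136352016, 539107841, 545787938, 541114440, 553714948,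
   538183824, 34636833, 35719234, 42213640, 37884036, 50872848, 84152385, 68305154, 69731464,
   75532804, 71376944, 1073741855, 1073742816, 1074757632, 1073773568, 1106247680, 2113929216]),
   ([0, 1, 3, 2, 4, 5, 6, 8, 7, 9, 15, 16, 18, 17, 19, 10, 11, 13, 12, 14, 20, 21, 23, 22, 24,
   25, 26, 28, 29, 27, 30], [273156353, 285253762, 269554184, 270811172, 276956240, 545341569,
   541328898, 553781288, 538452036, 539005200, 136454657, 143134754, 138461256, 151061764,
   135530640, 34636833, 35719234, 42213640, 37884036, 50872848, 84152385, 68305154, 69731464,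
   75532804, 71376944, 1073741855, 1073742816, 1074757632, 1073773568, 1106247680, 2113929216]),
   ([0, 1, 3, 2, 4, 5, 6, 8, 7, 9, 15, 16, 18, 17, 19, 10, 11, 13, 12, 14, 20, 21, 23, 22, 24,
   25, 26, 29, 27, 28, 30], [541591809, 553689218, 537989640, 539246628, 545391696, 142688385,
   138675714, 151128104, 135798852, 136352016, 270672385, 277352482, 272678984, 285279492,
   269748368, 34636833, 35719234, 42213640, 37884036, 50872848, 84152385, 68305154, 69731464,
   75532804, 71376944, 1073741855, 1073742816, 1074757632, 1073773568, 1106247680, 2113929216]),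
   ([0, 1, 3, 2, 4, 5, 6, 8, 7, 9, 15, 16, 18, 17, 19, 10, 11, 13, 12, 14, 20, 21, 23, 22, 24,
   25, 26, 29, 28, 27, 30], [541591809, 553689218, 537989640, 539246628, 545391696, 276906113,
   272893442, 285345832, 270016580, 270569744, 136454657, 143134754, 138461256, 151061764,
   135530640, 34636833, 35719234, 42213640, 37884036, 50872848, 84152385, 68305154, 69731464,
   75532804, 71376944, 1073741855, 1073742816, 1074757632, 1073773568, 1106247680, 2113929216]),
   ([0, 1, 3, 4, 2, 5, 6, 8, 9, 7, 15, 16, 18, 19, 17, 20, 21, 23, 24, 22, 10, 11, 13, 14, 12,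
   25, 26, 27, 28, 29, 30], [136462593, 142643714, 151061640, 138676272, 135798852, 272704001,
   269762690, 271061032, 276956240, 285247748, 545785985, 553787426, 541114440, 537989392,
   539231748, 34636833, 35719234, 42213640, 50872848, 37884036, 84152385, 71828738, 68291080,
   69247120, 75579428, 1073741855, 1073742816, 1074757632, 1106247680, 1073773568, 2113929216]),
   ([0, 1, 3, 4, 2, 5, 6, 8, 9, 7, 15, 16, 18, 19, 17, 20, 21, 23, 24, 22, 10, 11, 13, 14, 12,
   25, 26, 27, 29, 28, 30], [136462593, 142643714, 151061640, 138676272, 135798852, 541139457,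
   538198146, 539496488, 545391696, 553683204, 277350529, 285351970, 272678984, 269553936,
   270796292, 34636833, 35719234, 42213640, 50872848, 37884036, 84152385, 71828738, 68291080,
   69247120, 75579428, 1073741855, 1073742816, 1074757632, 1106247680, 1073773568, 2113929216]),
   ([0, 1, 3, 4, 2, 5, 6, 8, 9, 7, 15, 16, 18, 19, 17, 20, 21, 23, 24, 22, 10, 11, 13, 14, 12,
   25, 26, 28, 27, 29, 30], [270680321, 276861442, 285279368, 272894000, 270016580, 138486273,
   135544962, 136843304, 142738512, 151030020, 545785985, 553787426, 541114440, 537989392,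
   539231748, 34636833, 35719234, 42213640, 50872848, 37884036, 84152385, 71828738, 68291080,
   69247120, 75579428, 1073741855, 1073742816, 1074757632, 1106247680, 1073773568, 2113929216]),
   ([0, 1, 3, 4, 2, 5, 6, 8, 9, 7, 15, 16, 18, 19, 17, 20, 21, 23, 24, 22, 10, 11, 13, 14, 12,
   25, 26, 28, 29, 27, 30], [270680321, 276861442, 285279368, 272894000, 270016580, 541139457,
   538198146, 539496488, 545391696, 553683204, 143132801, 151134242, 138461256, 135336208,
   136578564, 34636833, 35719234, 42213640, 50872848, 37884036, 84152385, 71828738, 68291080,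
   69247120, 75579428, 1073741855, 1073742816, 1074757632, 1106247680, 1073773568, 2113929216]),
   ([0, 1, 3, 4, 2, 5, 6, 8, 9, 7, 15, 16, 18, 19, 17, 20, 21, 23, 24, 22, 10, 11, 13, 14, 12,
   25, 26, 29, 27, 28, 30], [539115777, 545296898, 553714824, 541329456, 538452036, 138486273,
   135544962, 136843304, 142738512, 151030020, 277350529, 285351970, 272678984, 269553936,
   270796292, 34636833, 35719234, 42213640, 50872848, 37884036, 84152385, 71828738, 68291080,
   69247120, 75579428, 1073741855, 1073742816, 1074757632, 1106247680, 1073773568, 2113929216]),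
   ([0, 1, 3, 4, 2, 5, 6, 8, 9, 7, 15, 16, 18, 19, 17, 20, 21, 23, 24, 22, 10, 11, 13, 14, 12,
   25, 26, 29, 28, 27, 30], [539115777, 545296898, 553714824, 541329456, 538452036, 272704001,
   269762690, 271061032, 276956240, 285247748, 143132801, 151134242, 138461256, 135336208,
   136578564, 34636833, 35719234, 42213640, 50872848, 37884036, 84152385, 71828738, 68291080,
   69247120, 75579428, 1073741855, 1073742816, 1074757632, 1106247680, 1073773568, 2113929216]),
   ([0, 1, 4, 2, 3, 5, 6, 9, 7, 8, 20, 21, 24, 22, 23, 10, 11, 14, 12, 13, 15, 16, 19, 17, 18,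
   25, 26, 27, 28, 29, 30], [142739969, 135544962, 136352016, 151068708, 138937416, 271065217,
   285345026, 272894000, 276873284, 269554184, 541147393, 545787938, 538058832, 539231748,
   553683080, 34636833, 35719234, 50872848, 37884036, 42213640, 84152385, 71344642, 75564176,
   68684036, 69353512, 1073741855, 1073742816, 1106247680, 1073773568, 1074757632, 2113929216]),
   ([0, 1, 4, 2, 3, 5, 6, 9, 7, 8, 20, 21, 24, 22, 23, 10, 11, 14, 12, 13, 15, 16, 19, 17, 18,
   25, 26, 27, 29, 28, 30], [142739969, 135544962, 136352016, 151068708, 138937416, 539500673,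
   553780482, 541329456, 545308740, 537989640, 272711937, 277352482, 269623376, 270796292,
   285247624, 34636833, 35719234, 50872848, 37884036, 42213640, 84152385, 71344642, 75564176,
   68684036, 69353512, 1073741855, 1073742816, 1106247680, 1073773568, 1074757632, 2113929216]),
   ([0, 1, 4, 2, 3, 5, 6, 9, 7, 8, 20, 21, 24, 22, 23, 10, 11, 14, 12, 13, 15, 16, 19, 17, 18,
   25, 26, 28, 27, 29, 30], [276957697, 269762690, 270569744, 285286436, 273155144, 136847489,
   151127298, 138676272, 142655556, 135336456, 541147393, 545787938, 538058832, 539231748,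
   553683080, 34636833, 35719234, 50872848, 37884036, 42213640, 84152385, 71344642, 75564176,
   68684036, 69353512, 1073741855, 1073742816, 1106247680, 1073773568, 1074757632, 2113929216]),
   ([0, 1, 4, 2, 3, 5, 6, 9, 7, 8, 20, 21, 24, 22, 23, 10, 11, 14, 12, 13, 15, 16, 19, 17, 18,
   25, 26, 28, 29, 27, 30], [276957697, 269762690, 270569744, 285286436, 273155144, 539500673,
   553780482, 541329456, 545308740, 537989640, 138494209, 143134754, 135405648, 136578564,
   151029896, 34636833, 35719234, 50872848, 37884036, 42213640, 84152385, 71344642, 75564176,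
   68684036, 69353512, 1073741855, 1073742816, 1106247680, 1073773568, 1074757632, 2113929216]),
   ([0, 1, 4, 2, 3, 5, 6, 9, 7, 8, 20, 21, 24, 22, 23, 10, 11, 14, 12, 13, 15, 16, 19, 17, 18,
   25, 26, 29, 27, 28, 30], [545393153, 538198146, 539005200, 553721892, 541590600, 136847489,
   151127298, 138676272, 142655556, 135336456, 272711937, 277352482, 269623376, 270796292,
   285247624, 34636833, 35719234, 50872848, 37884036, 42213640, 84152385, 71344642, 75564176,
   68684036, 69353512, 1073741855, 1073742816, 1106247680, 1073773568, 1074757632, 2113929216]),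
   ([0, 1, 4, 2, 3, 5, 6, 9, 7, 8, 20, 21, 24, 22, 23, 10, 11, 14, 12, 13, 15, 16, 19, 17, 18,
   25, 26, 29, 28, 27, 30], [545393153, 538198146, 539005200, 553721892, 541590600, 271065217,
   285345026, 272894000, 276873284, 269554184, 138494209, 143134754, 135405648, 136578564,
   151029896, 34636833, 35719234, 50872848, 37884036, 42213640, 84152385, 71344642, 75564176,
   68684036, 69353512, 1073741855, 1073742816, 1106247680, 1073773568, 1074757632, 2113929216]),
   ([0, 1, 4, 3, 2, 5, 6, 9, 8, 7, 20, 21, 24, 23, 22, 15, 16, 19, 18, 17, 10, 11, 14, 13, 12,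
   25, 26, 27, 28, 29, 30], [138486273, 135794946, 136578192, 151128104, 142655556, 270680321,
   285253762, 276893744, 273155144, 269748740, 545785985, 541343778, 538058832, 539005448,
   553714948, 34636833, 35719234, 50872848, 42213640, 37884036, 84152385, 75630082, 71338256,
   68239496, 69738532, 1073741855, 1073742816, 1106247680, 1074757632, 1073773568, 2113929216]),
   ([0, 1, 4, 3, 2, 5, 6, 9, 8, 7, 20, 21, 24, 23, 22, 15, 16, 19, 18, 17, 10, 11, 14, 13, 12,
   25, 26, 27, 29, 28, 30], [138486273, 135794946, 136578192, 151128104, 142655556, 539115777,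
   553689218, 545329200, 541590600, 538184196, 277350529, 272908322, 269623376, 270569992,
   285279492, 34636833, 35719234, 50872848, 42213640, 37884036, 84152385, 75630082, 71338256,
   68239496, 69738532, 1073741855, 1073742816, 1106247680, 1074757632, 1073773568, 2113929216]),
   ([0, 1, 4, 3, 2, 5, 6, 9, 8, 7, 20, 21, 24, 23, 22, 15, 16, 19, 18, 17, 10, 11, 14, 13, 12,
   25, 26, 28, 27, 29, 30], [272704001, 270012674, 270795920, 285345832, 276873284, 136462593,
   151036034, 142676016, 138937416, 135531012, 545785985, 541343778, 538058832, 539005448,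
   553714948, 34636833, 35719234, 50872848, 42213640, 37884036, 84152385, 75630082, 71338256,
   68239496, 69738532, 1073741855, 1073742816, 1106247680, 1074757632, 1073773568, 2113929216]),
   ([0, 1, 4, 3, 2, 5, 6, 9, 8, 7, 20, 21, 24, 23, 22, 15, 16, 19, 18, 17, 10, 11, 14, 13, 12,
   25, 26, 28, 29, 27, 30], [272704001, 270012674, 270795920, 285345832, 276873284, 539115777,
   553689218, 545329200, 541590600, 538184196, 143132801, 138690594, 135405648, 136352264,
   151061764, 34636833, 35719234, 50872848, 42213640, 37884036, 84152385, 75630082, 71338256,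
   68239496, 69738532, 1073741855, 1073742816, 1106247680, 1074757632, 1073773568, 2113929216]),
   ([0, 1, 4, 3, 2, 5, 6, 9, 8, 7, 20, 21, 24, 23, 22, 15, 16, 19, 18, 17, 10, 11, 14, 13, 12,
   25, 26, 29, 27, 28, 30], [541139457, 538448130, 539231376, 553781288, 545308740, 136462593,
   151036034, 142676016, 138937416, 135531012, 277350529, 272908322, 269623376, 270569992,
   285279492, 34636833, 35719234, 50872848, 42213640, 37884036, 84152385, 75630082, 71338256,
   68239496, 69738532, 1073741855, 1073742816, 1106247680, 1074757632, 1073773568, 2113929216]),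
   ([0, 1, 4, 3, 2, 5, 6, 9, 8, 7, 20, 21, 24, 23, 22, 15, 16, 19, 18, 17, 10, 11, 14, 13, 12,
   25, 26, 29, 28, 27, 30], [541139457, 538448130, 539231376, 553781288, 545308740, 270680321,
   285253762, 276893744, 273155144, 269748740, 143132801, 138690594, 135405648, 136352264,
   151061764, 34636833, 35719234, 50872848, 42213640, 37884036, 84152385, 75630082, 71338256,
   68239496, 69738532, 1073741855, 1073742816, 1106247680, 1074757632, 1073773568, 2113929216])]

/-- Ovals through the frame. -/
def imgsB5 : List (List ℕ × ℕ) :=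
  [([0, 5, 10, 15, 20, 1, 6, 11, 16, 21, 2, 7, 12, 17, 22, 3, 8, 13, 18, 23, 4, 9, 14, 19, 24,
   30, 26, 28, 27, 29, 25], 1107828801), ([0, 15, 5, 20, 10, 11, 6, 1, 21, 16, 8, 13, 18, 23, 3,
   19, 4, 14, 24, 9, 28, 27, 29, 30, 26, 22, 12, 2, 17, 7, 25], 1111507009), ([0, 1, 2, 3, 4, 5,
   6, 7, 8, 9, 10, 11, 12, 13, 14, 15, 16, 17, 18, 19, 20, 21, 22, 23, 24, 25, 26, 27, 28, 29,
   30], 1115816001)]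

theorem cA5 : check1 5 (2 ^ 31 - 1) known5 jsA5 slopes5 imgsA5 = true := by
  decide +kernel

theorem cB5 : check2 2 (2 ^ 31 - 1) 1107296321 std5 jsA5 imgsB5 = true := by
  decide +kernel

theorem cC5 : check3 5 4 (2 ^ 31 - 1) 1115816001 (2 ^ 6 ||| 2 ^ 25) std5 jsB5 centers5 =
    true := by
  decide +kernel

theorem final5 {P : Type*} [Fintype P] [DecidableEq P]
    {L₁ L₂ L₃ : Set (Finset P)} (h₁ : Pl 5 L₁) (h₂ : Pl 5 L₂) (h₃ : Pl 5 L₃)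
    (h12 : ∀ B ∈ L₁, ∀ C ∈ L₂, (B ∩ C).card ≤ 2)
    (h13 : ∀ B ∈ L₁, ∀ C ∈ L₃, (B ∩ C).card ≤ 2)
    (h23 : ∀ B ∈ L₂, ∀ C ∈ L₃, (B ∩ C).card ≤ 2) : False := by
  refine master (q := 5) (n := 31) (need2 := 2) (need3 := 4) (frame := 1107296321)
    (m0 := 1115816001) (i₁ := 6) (i₂ := 25) (std := std5) (known := known5) (js1 := jsA5)
    (slopes := slopes5) (js3 := jsB5) (centers := centers5) (imgs1 := imgsA5)
    (imgs2 := imgsB5) (by norm_num) (by norm_num) (by norm_num) ?_ ?_ ?_ ?_ ?_ ?_ ?_ ?_ ?_ ?_ ?_ ?_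
    cA5 cB5 cC5 h₁ h₂ h₃ h12 h13 h23
  · unfold JS; decide +kernel
  · unfold JS; decide +kernel
  · decide +kernel
  · decide +kernel
  · decide +kernel
  · unfold Perm; decide +kernel
  · norm_num
  · decide +kernel
  · unfold Perm; decide +kernel
  · decide +kernel
  · decide +kernel
  · norm_num

/-! ### Order two -/

theorem ptsK_spec' (lines js : List ℕ) : ∀ acc : List (ℕ × List ℕ), ∃ r,
    (∀ k, ptsK lines js acc k = k r) ∧
    ∀ b ∈ r, b ∈ acc ∨ (b.1 ∈ js ∧ ∀ l ∈ lines, has l b.1 = true → l ∈ b.2) := by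
  induction js with
  | nil => intro acc; exact ⟨acc, fun k => rfl, fun b hb => Or.inl hb⟩
  | cons j js ih =>
    intro acc
    obtain ⟨ls, h1, h2⟩ := filtK_spec (fun l => has l j) lines []
    obtain ⟨r, h3, h5⟩ := ih ((j, ls) :: acc)
    refine ⟨r, fun k => ?_, ?_⟩
    · show filtK (fun l => has l j) lines [] (fun ls => ptsK lines js ((j, ls) :: acc) k) = _
      rw [h1, h3]
    · intro b hb
      rcases h5 b hb with h | h
      · rcases List.mem_cons.1 h with rfl | h
        · right
          refine ⟨List.mem_cons_self, fun l hl hb => ?_⟩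
          rw [h2]; exact Or.inr ⟨hl, hb⟩
        · exact Or.inl h
      · exact Or.inr ⟨List.mem_cons_of_mem _ h.1, h.2⟩

theorem level_all {n q : ℕ} {S : ℕ → Prop} (hS : MP n q S) {js : List ℕ}
    (hjs : ∀ j ∈ js, ∃ i < n, j = 2 ^ i) {kf : List ℕ → List ℕ → Bool} {T a : List ℕ}
    (hT : ∀ c, S c → c ∈ T) {t : ℕ} (hta : t ∈ a) (ht : ∀ c, S c → le2 (Nat.land c t) = true)
    (h : (ptsK T js [] fun bs => levels js kf bs [] a) = true) :
    ∃ ch a', kf ch a' = true ∧ ∀ t ∈ a, (∀ c, S c → le2 (Nat.land c t) = true) → t ∈ a' := by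
  obtain ⟨bs, h1, h2⟩ := ptsK_spec' T js []
  rw [h1] at h
  obtain ⟨ch, a', e1, -, e2⟩ := levels_sound hS js hjs kf bs (by
    intro b hb
    rcases h2 b hb with h | ⟨h, h'⟩
    · cases h
    · obtain ⟨p, hp, hbp⟩ := hjs _ h
      refine ⟨p, hp, hbp, fun d hd hdp => h' d (hT d hd) ?_⟩
      rw [hbp, has_two_pow]; exact hdp) [] a (by simp) ⟨t, hta, ht⟩ h
  exact ⟨ch, a', e1, e2⟩

/-- No three mutually orthogoval planes with all blocks in `T`. -/
noncomputable def check0 (T js : List ℕ) : Bool :=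
  ptsK T js [] fun bs => levels js (fun _ a =>
    ptsK a js [] fun bs => levels js (fun _ a =>
      ptsK a js [] fun bs => levels js (fun _ _ => false) bs [] [0]) bs [] a) bs [] T

theorem check0_sound {n q : ℕ} {S₁ S₂ S₃ : ℕ → Prop} (h₁ : MP n q S₁) (h₂ : MP n q S₂)
    (h₃ : MP n q S₃) (hn : 2 ≤ n) {js T : List ℕ} (hjs : ∀ j ∈ js, ∃ i < n, j = 2 ^ i)
    (hT : ∀ c, c < 2 ^ n → (bits n c).card = q + 1 → c ∈ T)
    (h12 : ∀ c, S₁ c → ∀ d, S₂ d → Ov c d) (h13 : ∀ c, S₁ c → ∀ d, S₃ d → Ov c d)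
    (h23 : ∀ c, S₂ c → ∀ d, S₃ d → Ov c d) (h : check0 T js = true) : False := by
  obtain ⟨t2, ht2, -⟩ := h₂.ex 0 1 (by omega) (by omega) (by omega)
  obtain ⟨t3, ht3, -⟩ := h₃.ex 0 1 (by omega) (by omega) (by omega)
  obtain ⟨-, a, h, ha⟩ := level_all h₁ hjs (fun c hc => hT c (h₁.lt c hc) (h₁.card c hc))
    (hT t2 (h₂.lt _ ht2) (h₂.card _ ht2)) (fun c hc => (h12 c hc t2 ht2).le2) h
  have ha2 : ∀ c, S₂ c → c ∈ a := fun d hd =>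
    ha d (hT d (h₂.lt d hd) (h₂.card d hd)) (fun c hc => (h12 c hc d hd).le2)
  have ha3 : ∀ c, S₃ c → c ∈ a := fun d hd =>
    ha d (hT d (h₃.lt d hd) (h₃.card d hd)) (fun c hc => (h13 c hc d hd).le2)
  obtain ⟨-, a', h, ha'⟩ := level_all h₂ hjs ha2 (ha3 t3 ht3)
    (fun c hc => (h23 c hc t3 ht3).le2) h
  obtain ⟨-, -, h, -⟩ := level_all h₃ hjs
    (fun d hd => ha' d (ha3 d hd) (fun c hc => (h23 c hc d hd).le2))
    (List.mem_singleton.2 rfl)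
    (fun c _ => by rw [show Nat.land c 0 = 0 from Nat.and_zero c]; rfl) h
  cases h

/-- All triples of points. -/
def triples : List ℕ :=
  [7, 11, 13, 14, 19, 21, 22, 25, 26, 28, 35, 37, 38, 41, 42, 44, 49, 50,
   52, 56, 67, 69, 70, 73, 74, 76, 81, 82, 84, 88, 97, 98, 100, 104, 112]

/-- All points. -/
def jsA2 : List ℕ := [1, 2, 4, 8, 16, 32, 64]

theorem cA2 : check0 triples jsA2 = true := by
  decide +kernel

theorem final2 {P : Type*} [Fintype P] [DecidableEq P]
    {L₁ L₂ L₃ : Set (Finset P)} (h₁ : Pl 2 L₁) (h₂ : Pl 2 L₂) (h₃ : Pl 2 L₃)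
    (h12 : ∀ B ∈ L₁, ∀ C ∈ L₂, (B ∩ C).card ≤ 2)
    (h13 : ∀ B ∈ L₁, ∀ C ∈ L₃, (B ∩ C).card ≤ 2)
    (h23 : ∀ B ∈ L₂, ∀ C ∈ L₃, (B ∩ C).card ≤ 2) : False := by
  have hc : Fintype.card P = 7 := h₁.cardP
  let e := Fintype.equivFinOfCardEq hc
  obtain ⟨g, hg⟩ : ∃ g : ℕ → P, Lab 7 g := by
    refine ⟨fun i => if h : i < 7 then e.symm ⟨i, h⟩ else e.symm 0, ?_, ?_⟩
    · intro i hi j hj hij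
      simp only [dif_pos hi, dif_pos hj] at hij
      have := e.symm.injective hij
      exact congrArg Fin.val this
    · intro p
      refine ⟨(e p).1, (e p).2, ?_⟩
      simp
  refine check0_sound (h₁.mp (by omega) hg) (h₂.mp (by omega) hg) (h₃.mp (by omega) hg)
    (by omega) ?_ ?_ (fun c hc d hd => Ov_of hg h12 hc hd) (fun c hc d hd => Ov_of hg h13 hc hd)
    (fun c hc d hd => Ov_of hg h23 hc hd) cA2
  · decide +kernel
  · decide +kernel

end Ogo

theorem no_three_mutually_orthogoval_projective_planes
    (q : ℕ) (hq : q ∈ ({2, 4, 5} : Set ℕ))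
    (P : Type*) [Fintype P] [DecidableEq P] (hP : Fintype.card P = q ^ 2 + q + 1) :
    ¬ ∃ L : Fin 3 → Set (Finset P),
      (∀ i : Fin 3,
        (∀ B ∈ L i, B.card = q + 1) ∧
        (∀ x y : P, x ≠ y → ∃! B : Finset P, B ∈ L i ∧ x ∈ B ∧ y ∈ B)) ∧
      (∀ i j : Fin 3, i ≠ j →
        ∀ B₁ ∈ L i, ∀ B₂ ∈ L j, (B₁ ∩ B₂).card ≤ 2) := by
  rintro ⟨L, hL, hO⟩
  have hPl : ∀ i, Ogo.Pl q (L i) := by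
    intro i
    refine ⟨hP, (hL i).1, ?_, ?_⟩
    · intro x y hxy
      obtain ⟨B, hB, -⟩ := (hL i).2 x y hxy
      exact ⟨B, hB.1, hB.2.1, hB.2.2⟩
    · intro x y hxy B hB C hC h1 h2 h3 h4
      obtain ⟨D, -, hD⟩ := (hL i).2 x y hxy
      rw [hD B ⟨hB, h1, h2⟩, hD C ⟨hC, h3, h4⟩]
  have h12 := hO 0 1 (by decide)
  have h13 := hO 0 2 (by decide)
  have h23 := hO 1 2 (by decide)
  have k1 := hPl 0
  have k2 := hPl 1
  have k3 := hPl 2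
  simp only [Set.mem_insert_iff, Set.mem_singleton_iff] at hq
  rcases hq with rfl | rfl | rfl
  · exact Ogo.final2 k1 k2 k3 h12 h13 h23
  · exact Ogo.final4 k1 k2 k3 h12 h13 h23
  · exact Ogo.final5 k1 k2 k3 h12 h13 h23
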